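/- arXiv:2011.01572 — 2 statements merged into one kernel-verified Lean document; each statement's English description precedes it below -/
import Mathlib

section
/- For every n ∈ ℕ the element Y_{n+1} is central in 𝒜q, i.e. Y_{n+1}·x = x·Y_{n+1} for every x ∈ 𝒜q. -/
/- STATEMENT 3: the elements Y_{n+1} are central in 𝒜q. -/

noncomputable section

namespace Alt

/-- The base field `F = ℚ(q)`. -/
abbrev F : Type := RatFunc ℚ

/-- The indeterminate `q`. -/
def q : F := RatFunc.X

/-- Commutator `[x,y] = xy - yx`. -/
def br {A : Type*} [Ring A] (x y : A) : A := x * y - y * x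

/-- `q`-commutator `[x,y]_q = q·xy - q⁻¹·yx`. -/
def qbr {A : Type*} [Ring A] [Algebra F A] (x y : A) : A :=
  q • (x * y) - q⁻¹ • (y * x)

/-- `q⁻¹`-commutator `[x,y]_{q⁻¹} = q⁻¹·xy - q·yx`. -/
def qbr' {A : Type*} [Ring A] [Algebra F A] (x y : A) : A :=
  q⁻¹ • (x * y) - q • (y * x)

/-- Generators of the algebra `𝒜q`: `wm k ↦ W_{-k}`, `wp k ↦ W_{k+1}`,
`g k ↦ G_{k+1}`, `gt k ↦ G̃_{k+1}`. -/
inductive Gen : Type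
  | wm : ℕ → Gen
  | wp : ℕ → Gen
  | g : ℕ → Gen
  | gt : ℕ → Gen

/-- The free `F`-algebra on the generators. -/
abbrev FA : Type := FreeAlgebra F Gen

/-- `W_{-k}` in the free algebra. -/
def fWm (k : ℕ) : FA := FreeAlgebra.ι F (Gen.wm k)
/-- `W_{k+1}` in the free algebra. -/
def fWp (k : ℕ) : FA := FreeAlgebra.ι F (Gen.wp k)
/-- `G_{k+1}` in the free algebra. -/
def fG (k : ℕ) : FA := FreeAlgebra.ι F (Gen.g k)
/-- `G̃_{k+1}` in the free algebra. -/
def fGt (k : ℕ) : FA := FreeAlgebra.ι F (Gen.gt k)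

/-- The defining relations of `𝒜q` (with parameter `ρ`). -/
inductive rel (ρ : F) : FA → FA → Prop
  | r1a (k : ℕ) : rel ρ (br (fWm 0) (fWp k)) ((q + q⁻¹)⁻¹ • (fGt k - fG k))
  | r1b (k : ℕ) : rel ρ (br (fWm k) (fWp 0)) ((q + q⁻¹)⁻¹ • (fGt k - fG k))
  | r2a (k : ℕ) : rel ρ (qbr (fWm 0) (fG k)) (ρ • fWm (k + 1))
  | r2b (k : ℕ) : rel ρ (qbr (fGt k) (fWm 0)) (ρ • fWm (k + 1))
  | r3a (k : ℕ) : rel ρ (qbr (fG k) (fWp 0)) (ρ • fWp (k + 1))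
  | r3b (k : ℕ) : rel ρ (qbr (fWp 0) (fGt k)) (ρ • fWp (k + 1))
  | r4a (k l : ℕ) : rel ρ (br (fWm k) (fWm l)) 0
  | r4b (k l : ℕ) : rel ρ (br (fWp k) (fWp l)) 0
  | r5 (k l : ℕ) : rel ρ (br (fWm k) (fWp l) + br (fWp k) (fWm l)) 0
  | r6 (k l : ℕ) : rel ρ (br (fWm k) (fG l) + br (fG k) (fWm l)) 0
  | r7 (k l : ℕ) : rel ρ (br (fWm k) (fGt l) + br (fGt k) (fWm l)) 0
  | r8 (k l : ℕ) : rel ρ (br (fWp k) (fG l) + br (fG k) (fWp l)) 0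
  | r9 (k l : ℕ) : rel ρ (br (fWp k) (fGt l) + br (fGt k) (fWp l)) 0
  | r10a (k l : ℕ) : rel ρ (br (fG k) (fG l)) 0
  | r10b (k l : ℕ) : rel ρ (br (fGt k) (fGt l)) 0
  | r11 (k l : ℕ) : rel ρ (br (fGt k) (fG l) + br (fG k) (fGt l)) 0

/-- The algebra `𝒜q`: the quotient of the free algebra by the two-sided ideal
generated by the defining relations. -/
abbrev Aq (ρ : F) : Type := RingQuot (rel ρ)

/-- The generator `W_{-k}` of `𝒜q`. -/
def Wm (ρ : F) (k : ℕ) : Aq ρ := RingQuot.mkAlgHom F (rel ρ) (fWm k)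
/-- The generator `W_{k+1}` of `𝒜q`. -/
def Wp (ρ : F) (k : ℕ) : Aq ρ := RingQuot.mkAlgHom F (rel ρ) (fWp k)
/-- The generator `G_{k+1}` of `𝒜q`. -/
def G (ρ : F) (k : ℕ) : Aq ρ := RingQuot.mkAlgHom F (rel ρ) (fG k)
/-- The generator `G̃_{k+1}` of `𝒜q`. -/
def Gt (ρ : F) (k : ℕ) : Aq ρ := RingQuot.mkAlgHom F (rel ρ) (fGt k)

/-- The element `Y_{n+1}` of `𝒜q`. -/
def Y (ρ : F) (n : ℕ) : Aq ρ :=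
  q ^ (-(n : ℤ) - 1) • G ρ n + q ^ ((n : ℤ) + 1) • Gt ρ n -
    (q ^ (2 : ℤ) - q ^ (-2 : ℤ)) •
      ∑ k ∈ Finset.range (n + 1), q ^ (2 * (k : ℤ) - (n : ℤ)) • (Wm ρ k * Wp ρ (n - k)) +
    ((q - q⁻¹) / ρ) •
      ∑ k ∈ Finset.range n, q ^ (2 * (k : ℤ) - (n : ℤ) + 1) • (Gt ρ k * G ρ (n - 1 - k))

section Generic

open Finset.HasAntidiagonal (antidiagonal)

variable {K A : Type*} [Field K] [Ring A] [Algebra K A]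

/-- The power series `∑ aᵏ fₖ tᵏ`. -/
def ser (f : ℕ → A) (a : K) : PowerSeries A := PowerSeries.mk fun k => a ^ k • f k

theorem coeff_smul_series (n : ℕ) (c : K) (φ : PowerSeries A) :
    PowerSeries.coeff n (c • φ) = c • PowerSeries.coeff n φ := rfl

theorem coeff_ser (f : ℕ → A) (a : K) (n : ℕ) :
    PowerSeries.coeff n (ser f a) = a ^ n • f n := PowerSeries.coeff_mk _ _

theorem coeff_ser_mul (f h : ℕ → A) (a b : K) (n : ℕ) :
    PowerSeries.coeff n (ser f a * ser h b) =
      ∑ p ∈ antidiagonal n, (a ^ p.1 * b ^ p.2) • (f p.1 * h p.2) := by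
  simp only [PowerSeries.coeff_mul, coeff_ser, smul_mul_smul_comm]

theorem coeff_ser_scaled_commutator (f h : ℕ → A) (c₁ c₂ a b : K) (n : ℕ) :
    PowerSeries.coeff n (c₁ • (ser f a * ser h b) - c₂ • (ser h b * ser f a)) =
      ∑ p ∈ antidiagonal n,
        (a ^ p.1 * b ^ p.2) • (c₁ • (f p.1 * h p.2) - c₂ • (h p.2 * f p.1)) := by
  rw [map_sub, coeff_smul_series, coeff_smul_series, coeff_ser_mul, coeff_ser_mul,
    ← Finset.Nat.sum_antidiagonal_swap (f := fun p => (b ^ p.1 * a ^ p.2) • (h p.1 * f p.2)),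
    Finset.smul_sum, Finset.smul_sum, ← Finset.sum_sub_distrib]
  refine Finset.sum_congr rfl fun p _ => ?_
  simp only [Prod.fst_swap, Prod.snd_swap]
  module

theorem coeff_ser_commutator (f h : ℕ → A) (a b : K) (n : ℕ) :
    PowerSeries.coeff n (ser f a * ser h b - ser h b * ser f a) =
      ∑ p ∈ antidiagonal n, (a ^ p.1 * b ^ p.2) • (f p.1 * h p.2 - h p.2 * f p.1) := by
  simpa only [one_smul] using coeff_ser_scaled_commutator f h 1 1 a b n

/-- A symmetric array of scaled commutators gives a symmetric identity of series. -/
theorem ser_symm (f h : ℕ → A) (c₁ c₂ a b : K)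
    (H : ∀ k l, c₁ • (f k * h l) - c₂ • (h l * f k) = c₁ • (f l * h k) - c₂ • (h k * f l)) :
    c₁ • (ser f a * ser h b) - c₂ • (ser h b * ser f a) =
      c₁ • (ser f b * ser h a) - c₂ • (ser h a * ser f b) := by
  ext n
  rw [coeff_ser_scaled_commutator, coeff_ser_scaled_commutator,
    ← Finset.Nat.sum_antidiagonal_swap]
  refine Finset.sum_congr rfl fun p _ => ?_
  simp only [Prod.fst_swap, Prod.snd_swap, H p.2 p.1, mul_comm]

theorem ser_commute (f h : ℕ → A) (a b : K) (H : ∀ k l, f k * h l = h l * f k) :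
    ser f a * ser h b = ser h b * ser f a := by
  rw [← sub_eq_zero]
  ext n
  simp [coeff_ser_commutator, H]

/-- A shifted symmetric array of commutators gives a symmetric identity of series. -/
theorem ser_symm_shift (f h : ℕ → A) (a b : K) (h0 : ∀ x : A, h 0 * x = x * h 0)
    (H : ∀ k l, f k * h (l + 1) - h (l + 1) * f k = f l * h (k + 1) - h (k + 1) * f l) :
    a • (ser f a * ser h b - ser h b * ser f a) =
      b • (ser f b * ser h a - ser h a * ser f b) := by
  ext n
  rw [coeff_smul_series, coeff_smul_series, coeff_ser_commutator, coeff_ser_commutator]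
  cases n with
  | zero => simp [h0]
  | succ n =>
    rw [Finset.Nat.sum_antidiagonal_succ', Finset.Nat.sum_antidiagonal_succ']
    simp only [h0, sub_self, smul_zero, zero_add, Finset.smul_sum]
    nth_rewrite 2 [← Finset.Nat.sum_antidiagonal_swap]
    refine Finset.sum_congr rfl fun p _ => ?_
    simp only [Prod.fst_swap, Prod.snd_swap, H p.1 p.2]
    module

/-- A commutator array whose differences along antidiagonals are antisymmetrised products. -/
theorem ser_telescope (h g m p : ℕ → A) (a b c : K) (h0 : ∀ x : A, h 0 * x = x * h 0)
    (g0 : ∀ x : A, g 0 * x = x * g 0)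
    (H : ∀ k l, (h k * g (l + 1) - g (l + 1) * h k) - (h (k + 1) * g l - g l * h (k + 1)) =
      c • (m k * p l - m l * p k)) :
    (a - b) • (ser h a * ser g b - ser g b * ser h a) =
      (c * a * b) • (PowerSeries.X * (ser m a * ser p b - ser m b * ser p a)) := by
  ext n
  rw [coeff_smul_series, coeff_smul_series, coeff_ser_commutator]
  cases n with
  | zero => simp [h0]
  | succ n =>
    rw [PowerSeries.coeff_succ_X_mul, map_sub, coeff_ser_mul, coeff_ser_mul,
      ← Finset.Nat.sum_antidiagonal_swap (f := fun x => (b ^ x.1 * a ^ x.2) • (m x.1 * p x.2)),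
      sub_smul]
    nth_rewrite 1 [Finset.Nat.sum_antidiagonal_succ']
    rw [Finset.Nat.sum_antidiagonal_succ]
    simp only [h0, g0, sub_self, smul_zero, zero_add, Finset.smul_sum,
      ← Finset.sum_sub_distrib]
    refine Finset.sum_congr rfl fun x _ => ?_
    simp only [Prod.fst_swap, Prod.snd_swap]
    linear_combination (norm := module) (a ^ (x.1 + 1) * b ^ (x.2 + 1)) • H x.1 x.2

omit [Algebra K A] in
theorem X_mul_series (φ : PowerSeries A) : φ * PowerSeries.X = PowerSeries.X * φ :=
  PowerSeries.commute_X φ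

/-- Solving the symmetric and shifted symmetric identities for one ordering of the factors. -/
theorem mul_swap_of_symm {B : Type*} [Ring B] [Algebra K B] {Ma Mb Ga Gb : B} {c₁ c₂ a b : K}
    (h₁ : c₁ • (Ma * Gb) - c₂ • (Gb * Ma) = c₁ • (Mb * Ga) - c₂ • (Ga * Mb))
    (h₂ : a • (Ma * Gb - Gb * Ma) = b • (Mb * Ga - Ga * Mb)) :
    (c₂ * (a - b)) • (Gb * Ma) =
      (c₂ * a - c₁ * b) • (Ma * Gb) + (b * (c₁ - c₂)) • (Mb * Ga) := by
  linear_combination (norm := module) b • h₁ - c₂ • h₂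

/-- Solving the symmetric and shifted symmetric identities for the other ordering of the factors. -/
theorem mul_of_symm {B : Type*} [Ring B] [Algebra K B] {Ma Mb Ga Gb : B} {c₁ c₂ a b : K}
    (h₁ : c₁ • (Ma * Gb) - c₂ • (Gb * Ma) = c₁ • (Mb * Ga) - c₂ • (Ga * Mb))
    (h₂ : a • (Ma * Gb - Gb * Ma) = b • (Mb * Ga - Ga * Mb)) :
    (c₁ * (a - b)) • (Ma * Gb) =
      (c₁ * a - c₂ * b) • (Gb * Ma) + (b * (c₂ - c₁)) • (Ga * Mb) := by
  linear_combination (norm := module) c₁ • h₂ - b • h₁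

/-- If `fₖ` is a scaled commutator of `x` with a commuting family `gₖ`, the same scaled
commutator of `fₖ` and `gₗ` is symmetric in `k` and `l`. -/
theorem scaled_commutator_symm (x : A) (f g : ℕ → A) (ρ c₁ c₂ : K) (hρ : ρ ≠ 0)
    (hf : ∀ k, c₁ • (x * g k) - c₂ • (g k * x) = ρ • f k) (hg : ∀ k l, g k * g l = g l * g k)
    (k l : ℕ) :
    c₁ • (f k * g l) - c₂ • (g l * f k) = c₁ • (f l * g k) - c₂ • (g k * f l) := by
  have hf' : ∀ k, f k = ρ⁻¹ • (c₁ • (x * g k) - c₂ • (g k * x)) := fun k => by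
    rw [hf, inv_smul_smul₀ hρ]
  rw [hf' k, hf' l]
  simp only [smul_mul_assoc, mul_smul_comm, sub_mul, mul_sub, mul_assoc, smul_sub]
  rw [hg l k, ← mul_assoc (g l) (g k) x, hg l k, mul_assoc]
  module

/-- A finite sequence is zero if its generating polynomial vanishes outside a finite set. -/
theorem eq_zero_of_sum_pow_smul [Infinite K] (N : ℕ) (f : ℕ → A) (S : Set K) (hS : S.Finite)
    (H : ∀ a ∉ S, ∑ j ∈ Finset.range N, a ^ j • f j = 0) : ∀ j < N, f j = 0 := by
  intro j hj
  rw [← Module.forall_dual_apply_eq_zero_iff K]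
  intro φ
  have : (∑ j ∈ Finset.range N, Polynomial.monomial j (φ (f j))) = 0 := by
    refine Polynomial.eq_zero_of_infinite_isRoot _ (hS.infinite_compl.mono fun a ha => ?_)
    have := congrArg φ (H a ha)
    simpa [Polynomial.eval_finsetSum, Polynomial.eval_monomial, mul_comm] using this
  have := congrArg (fun P => Polynomial.coeff P j) this
  simpa [Polynomial.finsetSum_coeff, Polynomial.coeff_monomial, hj] using this

end Generic

section QuantumDeterminant

variable {K B : Type*} [Field K] [Ring B] [Algebra K B]

theorem commute_of_exchange {z s κ : K} (hz : z ≠ 0) (hs : s ≠ z) (hs' : s ≠ z⁻¹)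
    {hu gu gv gs Mu Ms Pu Pv Ps T : B}
    (e₁ : (z - s) • (hu * gs - gs * hu) =
      (κ * (z - z⁻¹) * z * s) • (T * (Mu * Ps - Ms * Pu)))
    (e₂ : (s - z⁻¹) • (Ps * gv) = (s - z) • (gv * Ps) + (z - z⁻¹) • (gs * Pv))
    (e₃ : Pu * gv = gu * Pv)
    (e₄ : (z⁻¹ - s) • (Pv * gs) = (z⁻¹ - z ^ 2 * s) • (gs * Pv) + (s * (z ^ 2 - 1)) • (gv * Ps))
    (e₅ : (z⁻¹ * (z - s)) • (gs * Mu) = (1 - z * s) • (Mu * gs) + (s * (z - z⁻¹)) • (Ms * gu))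
    (hg : gs * gv = gv * gs) (hT : gs * T = T * gs) :
    Commute (hu * gv - κ • (T * (Mu * Pv))) gs := by
  have h₁ : z - s ≠ 0 := sub_ne_zero.mpr hs.symm
  have h₂ : s - z⁻¹ ≠ 0 := sub_ne_zero.mpr hs'
  have h₃ : s * z - 1 ≠ 0 := fun h => hs' (by field_simp; linear_combination h)
  have h₄ : z * s - 1 ≠ 0 := by rwa [mul_comm]
  have f₁ := congrArg (· * gv) e₁
  have f₂ := congrArg (T * Mu * ·) e₂
  have f₃ := congrArg (T * Ms * ·) e₃
  have f₄ := congrArg (T * Mu * ·) e₄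
  have f₅ := congrArg (T * · * Pv) e₅
  have hgT : ∀ x, gs * (T * x) = T * (gs * x) := fun x => by rw [← mul_assoc, hT, mul_assoc]
  simp only [mul_add, add_mul, mul_sub, sub_mul, smul_mul_assoc, mul_smul_comm, mul_assoc, hg]
    at f₁ f₂ f₃ f₄ f₅
  unfold Commute SemiconjBy
  simp only [mul_sub, sub_mul, smul_mul_assoc, mul_smul_comm, mul_assoc, hgT]
  linear_combination (norm := skip) (z - s)⁻¹ • f₁
    + (κ * (z - z⁻¹) * z * s / ((z - s) * (s - z⁻¹))) • f₂
    - (κ * (z - z⁻¹) * z * s / (z - s)) • f₃ + (κ / (s - z⁻¹)) • f₄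
    + (κ * z / (z - s)) • f₅
  match_scalars <;> field_simp <;> ring

theorem commute_of_left_relations {z ρ θ : K} (hz : z ≠ 0)
    {m₀ hu hv gv Mu Mv Pv T : B}
    (r₁ : z • (m₀ * gv) - z⁻¹ • (gv * m₀) = ρ • Mv)
    (r₂ : z • (hu * m₀) - z⁻¹ • (m₀ * hu) = ρ • Mu)
    (r₃ : θ • (T * (m₀ * Pv - Pv * m₀)) = z • (hv - gv))
    (r₄ : hu * Mv = Mu * hv) (hM : m₀ * Mu = Mu * m₀) (hT : ∀ x, x * T = T * x) :
    Commute (hu * gv - (ρ * θ) • (T * (Mu * Pv))) m₀ := by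
  have f₁ := congrArg (hu * ·) r₁
  have f₂ := congrArg (· * gv) r₂
  have f₃ := congrArg (Mu * ·) r₃
  have hmT : ∀ x, m₀ * (T * x) = T * (m₀ * x) := fun x => by rw [← mul_assoc, hT, mul_assoc]
  have hMT : ∀ x, Mu * (T * x) = T * (Mu * x) := fun x => by rw [← mul_assoc, hT, mul_assoc]
  have hmM : ∀ x, m₀ * (Mu * x) = Mu * (m₀ * x) := fun x => by rw [← mul_assoc, hM, mul_assoc]
  simp only [mul_sub, sub_mul, smul_mul_assoc, mul_smul_comm, mul_assoc, hMT] at f₁ f₂ f₃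
  unfold Commute SemiconjBy
  simp only [mul_sub, sub_mul, smul_mul_assoc, mul_smul_comm, mul_assoc, hmT, hmM]
  linear_combination (norm := skip) z • f₂ - z • f₁ - (z * ρ) • r₄ + ρ • f₃
  match_scalars <;> field_simp <;> ring

theorem commute_of_right_relations {z ρ θ : K} (hz : z ≠ 0)
    {p₀ hu gu gv Mu Pu Pv T : B}
    (r₁ : z • (gv * p₀) - z⁻¹ • (p₀ * gv) = ρ • Pv)
    (r₂ : z • (p₀ * hu) - z⁻¹ • (hu * p₀) = ρ • Pu)
    (r₃ : θ • (T * (Mu * p₀ - p₀ * Mu)) = z⁻¹ • (hu - gu))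
    (r₄ : Pu * gv = gu * Pv) (hP : p₀ * Pv = Pv * p₀) (hT : ∀ x, x * T = T * x) :
    Commute (hu * gv - (ρ * θ) • (T * (Mu * Pv))) p₀ := by
  have f₁ := congrArg (hu * ·) r₁
  have f₂ := congrArg (· * gv) r₂
  have f₃ := congrArg (· * Pv) r₃
  have hpT : ∀ x, p₀ * (T * x) = T * (p₀ * x) := fun x => by rw [← mul_assoc, hT, mul_assoc]
  simp only [mul_sub, sub_mul, smul_mul_assoc, mul_smul_comm, mul_assoc] at f₁ f₂ f₃
  unfold Commute SemiconjBy
  simp only [mul_sub, sub_mul, smul_mul_assoc, mul_smul_comm, mul_assoc, hpT, ← hP]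
  linear_combination (norm := skip) z⁻¹ • f₁ - z⁻¹ • f₂ - (z⁻¹ * ρ) • r₄ - ρ • f₃
  match_scalars <;> field_simp <;> ring

end QuantumDeterminant

theorem q_ne_zero : q ≠ 0 := RatFunc.X_ne_zero

theorem q_pow_ne_C {n : ℕ} (hn : 0 < n) (c : ℚ) : q ^ n ≠ RatFunc.C c := by
  intro h
  rw [q, ← RatFunc.algebraMap_X, ← RatFunc.algebraMap_C, ← map_pow] at h
  have := congrArg Polynomial.natDegree (RatFunc.algebraMap_injective ℚ h)
  simp at this
  omega

theorem q_sq_ne_one : q ^ 2 ≠ 1 := by simpa using q_pow_ne_C two_pos 1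

theorem q_sub_inv_ne_zero : q - q⁻¹ ≠ 0 := fun h => q_sq_ne_one <| by
  have := q_ne_zero
  field_simp at h
  linear_combination h

theorem q_add_inv_ne_zero : q + q⁻¹ ≠ 0 := fun h => q_pow_ne_C two_pos (-1) <| by
  have := q_ne_zero
  field_simp at h
  rw [map_neg, map_one]
  linear_combination h

/-- The scalar action of `ℕ` on `F` used by `module`; the instance found by default comes from
the polynomial algebra structure of `RatFunc`. -/
local instance : Algebra ℕ F := Semiring.toNatAlgebra

/-- The scalar action of `ℤ` on `F` used by `module`. -/
local instance : Algebra ℤ F := Ring.toIntAlgebra F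

section Relations

variable (ρ : F)

theorem Wm_zero_Wp (k : ℕ) :
    Wm ρ 0 * Wp ρ k - Wp ρ k * Wm ρ 0 = (q + q⁻¹)⁻¹ • (Gt ρ k - G ρ k) := by
  simpa [br, Wm, Wp, G, Gt] using RingQuot.mkAlgHom_rel F (rel.r1a (ρ := ρ) k)

theorem Wm_Wp_zero (k : ℕ) :
    Wm ρ k * Wp ρ 0 - Wp ρ 0 * Wm ρ k = (q + q⁻¹)⁻¹ • (Gt ρ k - G ρ k) := by
  simpa [br, Wm, Wp, G, Gt] using RingQuot.mkAlgHom_rel F (rel.r1b (ρ := ρ) k)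

theorem Wm_zero_G (k : ℕ) :
    q • (Wm ρ 0 * G ρ k) - q⁻¹ • (G ρ k * Wm ρ 0) = ρ • Wm ρ (k + 1) := by
  simpa [qbr, Wm, Wp, G, Gt] using RingQuot.mkAlgHom_rel F (rel.r2a (ρ := ρ) k)

theorem Gt_Wm_zero (k : ℕ) :
    q • (Gt ρ k * Wm ρ 0) - q⁻¹ • (Wm ρ 0 * Gt ρ k) = ρ • Wm ρ (k + 1) := by
  simpa [qbr, Wm, Wp, G, Gt] using RingQuot.mkAlgHom_rel F (rel.r2b (ρ := ρ) k)

theorem G_Wp_zero (k : ℕ) :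
    q • (G ρ k * Wp ρ 0) - q⁻¹ • (Wp ρ 0 * G ρ k) = ρ • Wp ρ (k + 1) := by
  simpa [qbr, Wm, Wp, G, Gt] using RingQuot.mkAlgHom_rel F (rel.r3a (ρ := ρ) k)

theorem Wp_zero_Gt (k : ℕ) :
    q • (Wp ρ 0 * Gt ρ k) - q⁻¹ • (Gt ρ k * Wp ρ 0) = ρ • Wp ρ (k + 1) := by
  simpa [qbr, Wm, Wp, G, Gt] using RingQuot.mkAlgHom_rel F (rel.r3b (ρ := ρ) k)

theorem Wm_comm (k l : ℕ) : Wm ρ k * Wm ρ l = Wm ρ l * Wm ρ k := by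
  simpa [br, Wm, sub_eq_zero] using RingQuot.mkAlgHom_rel F (rel.r4a (ρ := ρ) k l)

theorem Wp_comm (k l : ℕ) : Wp ρ k * Wp ρ l = Wp ρ l * Wp ρ k := by
  simpa [br, Wp, sub_eq_zero] using RingQuot.mkAlgHom_rel F (rel.r4b (ρ := ρ) k l)

theorem G_comm (k l : ℕ) : G ρ k * G ρ l = G ρ l * G ρ k := by
  simpa [br, G, sub_eq_zero] using RingQuot.mkAlgHom_rel F (rel.r10a (ρ := ρ) k l)

theorem Gt_comm (k l : ℕ) : Gt ρ k * Gt ρ l = Gt ρ l * Gt ρ k := by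
  simpa [br, Gt, sub_eq_zero] using RingQuot.mkAlgHom_rel F (rel.r10b (ρ := ρ) k l)

theorem Wm_Wp_symm (k l : ℕ) :
    Wm ρ k * Wp ρ l - Wp ρ l * Wm ρ k = Wm ρ l * Wp ρ k - Wp ρ k * Wm ρ l := by
  have : (Wm ρ k * Wp ρ l - Wp ρ l * Wm ρ k) + (Wp ρ k * Wm ρ l - Wm ρ l * Wp ρ k) = 0 := by
    simpa [br, Wm, Wp] using RingQuot.mkAlgHom_rel F (rel.r5 (ρ := ρ) k l)
  linear_combination (norm := abel) this

theorem Wm_G_symm (k l : ℕ) :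
    Wm ρ k * G ρ l - G ρ l * Wm ρ k = Wm ρ l * G ρ k - G ρ k * Wm ρ l := by
  have : (Wm ρ k * G ρ l - G ρ l * Wm ρ k) + (G ρ k * Wm ρ l - Wm ρ l * G ρ k) = 0 := by
    simpa [br, Wm, G] using RingQuot.mkAlgHom_rel F (rel.r6 (ρ := ρ) k l)
  linear_combination (norm := abel) this

theorem Wm_Gt_symm (k l : ℕ) :
    Wm ρ k * Gt ρ l - Gt ρ l * Wm ρ k = Wm ρ l * Gt ρ k - Gt ρ k * Wm ρ l := by
  have : (Wm ρ k * Gt ρ l - Gt ρ l * Wm ρ k) + (Gt ρ k * Wm ρ l - Wm ρ l * Gt ρ k) = 0 := by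
    simpa [br, Wm, Gt] using RingQuot.mkAlgHom_rel F (rel.r7 (ρ := ρ) k l)
  linear_combination (norm := abel) this

theorem Wp_G_symm (k l : ℕ) :
    Wp ρ k * G ρ l - G ρ l * Wp ρ k = Wp ρ l * G ρ k - G ρ k * Wp ρ l := by
  have : (Wp ρ k * G ρ l - G ρ l * Wp ρ k) + (G ρ k * Wp ρ l - Wp ρ l * G ρ k) = 0 := by
    simpa [br, Wp, G] using RingQuot.mkAlgHom_rel F (rel.r8 (ρ := ρ) k l)
  linear_combination (norm := abel) this

theorem Gt_G_symm (k l : ℕ) :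
    Gt ρ k * G ρ l - G ρ l * Gt ρ k = Gt ρ l * G ρ k - G ρ k * Gt ρ l := by
  have : (Gt ρ k * G ρ l - G ρ l * Gt ρ k) + (G ρ k * Gt ρ l - Gt ρ l * G ρ k) = 0 := by
    simpa [br, Gt, G] using RingQuot.mkAlgHom_rel F (rel.r11 (ρ := ρ) k l)
  linear_combination (norm := abel) this

/-- The sequence `G_k`, where `G_0 = ρ / (q - q⁻¹)`. -/
def G₀ : ℕ → Aq ρ
  | 0 => algebraMap F (Aq ρ) (ρ / (q - q⁻¹))
  | k + 1 => G ρ k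

/-- The sequence `G̃_k`, where `G̃_0 = ρ / (q - q⁻¹)`. -/
def Gt₀ : ℕ → Aq ρ
  | 0 => algebraMap F (Aq ρ) (ρ / (q - q⁻¹))
  | k + 1 => Gt ρ k

theorem G₀_zero_comm (x : Aq ρ) : G₀ ρ 0 * x = x * G₀ ρ 0 := Algebra.commutes _ _

theorem Gt₀_zero_comm (x : Aq ρ) : Gt₀ ρ 0 * x = x * Gt₀ ρ 0 := Algebra.commutes _ _

theorem G₀_comm (k l : ℕ) : G₀ ρ k * G₀ ρ l = G₀ ρ l * G₀ ρ k := by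
  cases k <;> cases l
  all_goals first
    | rfl | exact G₀_zero_comm ρ _ | exact (G₀_zero_comm ρ _).symm | exact G_comm ρ _ _

theorem Gt₀_comm (k l : ℕ) : Gt₀ ρ k * Gt₀ ρ l = Gt₀ ρ l * Gt₀ ρ k := by
  cases k <;> cases l
  all_goals first
    | rfl | exact Gt₀_zero_comm ρ _ | exact (Gt₀_zero_comm ρ _).symm | exact Gt_comm ρ _ _

theorem scaled_commutator_algebraMap {A : Type*} [Ring A] [Algebra F A] (ρ : F) (x : A) :
    q • (x * algebraMap F A (ρ / (q - q⁻¹))) - q⁻¹ • (algebraMap F A (ρ / (q - q⁻¹)) * x) =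
      ρ • x := by
  have := q_sub_inv_ne_zero
  rw [Algebra.commutes, ← sub_smul, ← Algebra.commutes, ← Algebra.smul_def, smul_smul,
    mul_div_cancel₀ _ this]

theorem Wm_zero_G₀ (k : ℕ) :
    q • (Wm ρ 0 * G₀ ρ k) - q⁻¹ • (G₀ ρ k * Wm ρ 0) = ρ • Wm ρ k := by
  cases k with
  | zero => exact scaled_commutator_algebraMap ρ _
  | succ k => exact Wm_zero_G ρ k

theorem Gt₀_Wm_zero (k : ℕ) :
    q • (Gt₀ ρ k * Wm ρ 0) - q⁻¹ • (Wm ρ 0 * Gt₀ ρ k) = ρ • Wm ρ k := by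
  cases k with
  | zero =>
    rw [Gt₀_zero_comm]
    nth_rewrite 2 [← Gt₀_zero_comm]
    exact scaled_commutator_algebraMap ρ _
  | succ k => exact Gt_Wm_zero ρ k

theorem G₀_Wp_zero (k : ℕ) :
    q • (G₀ ρ k * Wp ρ 0) - q⁻¹ • (Wp ρ 0 * G₀ ρ k) = ρ • Wp ρ k := by
  cases k with
  | zero =>
    rw [G₀_zero_comm]
    nth_rewrite 2 [← G₀_zero_comm]
    exact scaled_commutator_algebraMap ρ _
  | succ k => exact G_Wp_zero ρ k

theorem Wp_zero_Gt₀ (k : ℕ) :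
    q • (Wp ρ 0 * Gt₀ ρ k) - q⁻¹ • (Gt₀ ρ k * Wp ρ 0) = ρ • Wp ρ k := by
  cases k with
  | zero => exact scaled_commutator_algebraMap ρ _
  | succ k => exact Wp_zero_Gt ρ k

theorem Gt₀_G₀_symm (k l : ℕ) :
    Gt₀ ρ k * G₀ ρ l - G₀ ρ l * Gt₀ ρ k = Gt₀ ρ l * G₀ ρ k - G₀ ρ k * Gt₀ ρ l := by
  rcases k with _ | k
  · rw [Gt₀_zero_comm, sub_self, G₀_zero_comm, sub_self]
  · rcases l with _ | l
    · rw [G₀_zero_comm, sub_self, Gt₀_zero_comm, sub_self]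
    · exact Gt_G_symm ρ k l

variable {ρ} (hρ : ρ ≠ 0)

include hρ

theorem Wm_G₀_scaled_symm (k l : ℕ) :
    q • (Wm ρ k * G₀ ρ l) - q⁻¹ • (G₀ ρ l * Wm ρ k) =
      q • (Wm ρ l * G₀ ρ k) - q⁻¹ • (G₀ ρ k * Wm ρ l) :=
  scaled_commutator_symm _ _ _ ρ _ _ hρ (Wm_zero_G₀ ρ) (G₀_comm ρ) k l

theorem Wm_Gt₀_scaled_symm (k l : ℕ) :
    (-q⁻¹) • (Wm ρ k * Gt₀ ρ l) - (-q) • (Gt₀ ρ l * Wm ρ k) =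
      (-q⁻¹) • (Wm ρ l * Gt₀ ρ k) - (-q) • (Gt₀ ρ k * Wm ρ l) :=
  scaled_commutator_symm _ _ _ ρ _ _ hρ
    (fun k => by rw [← Gt₀_Wm_zero]; module) (Gt₀_comm ρ) k l

theorem Wp_G₀_scaled_symm (k l : ℕ) :
    (-q⁻¹) • (Wp ρ k * G₀ ρ l) - (-q) • (G₀ ρ l * Wp ρ k) =
      (-q⁻¹) • (Wp ρ l * G₀ ρ k) - (-q) • (G₀ ρ k * Wp ρ l) :=
  scaled_commutator_symm _ _ _ ρ _ _ hρ
    (fun k => by rw [← G₀_Wp_zero]; module) (G₀_comm ρ) k l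

theorem Wp_Gt₀_scaled_symm (k l : ℕ) :
    q • (Wp ρ k * Gt₀ ρ l) - q⁻¹ • (Gt₀ ρ l * Wp ρ k) =
      q • (Wp ρ l * Gt₀ ρ k) - q⁻¹ • (Gt₀ ρ k * Wp ρ l) :=
  scaled_commutator_symm _ _ _ ρ _ _ hρ (Wp_zero_Gt₀ ρ) (Gt₀_comm ρ) k l

omit hρ in
theorem Gt₀_G_commutator (k l : ℕ) :
    Gt₀ ρ k * G ρ l - G ρ l * Gt₀ ρ k = (q + q⁻¹) •
      ((q * ρ) • (Wp ρ l * Wm ρ k) - (q⁻¹ * ρ) • (Wm ρ k * Wp ρ l)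
        - q • ((q • (Wp ρ l * Gt₀ ρ k) - q⁻¹ • (Gt₀ ρ k * Wp ρ l)) * Wm ρ 0)
        + q⁻¹ • (Wm ρ 0 * (q • (Wp ρ l * Gt₀ ρ k) - q⁻¹ • (Gt₀ ρ k * Wp ρ l)))) := by
  have hq := q_ne_zero
  have hG : G ρ l = Gt ρ l - (q + q⁻¹) • (Wm ρ 0 * Wp ρ l - Wp ρ l * Wm ρ 0) := by
    rw [Wm_zero_Wp, smul_inv_smul₀ q_add_inv_ne_zero, sub_sub_cancel]
  have hGt : Gt₀ ρ k * Gt ρ l = Gt ρ l * Gt₀ ρ k := Gt₀_comm ρ k (l + 1)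
  have h₁ := congrArg (Wp ρ l * ·) (Gt₀_Wm_zero ρ k)
  have h₂ := congrArg (· * Wp ρ l) (Gt₀_Wm_zero ρ k)
  rw [hG]
  simp only [mul_sub, sub_mul, smul_mul_assoc, mul_smul_comm, mul_assoc] at h₁ h₂ ⊢
  linear_combination (norm := skip) hGt - ((q + q⁻¹) * q⁻¹) • h₂ + ((q + q⁻¹) * q) • h₁
  match_scalars <;> field_simp <;> ring

theorem Gt₀_G₀_antidiagonal_difference (k l : ℕ) :
    (Gt₀ ρ k * G₀ ρ (l + 1) - G₀ ρ (l + 1) * Gt₀ ρ k) -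
        (Gt₀ ρ (k + 1) * G₀ ρ l - G₀ ρ l * Gt₀ ρ (k + 1)) =
      (ρ * (q + q⁻¹) * (q - q⁻¹)) • (Wm ρ k * Wp ρ l - Wm ρ l * Wp ρ k) := by
  rw [Gt₀_G₀_symm ρ (k + 1) l]
  change (Gt₀ ρ k * G ρ l - G ρ l * Gt₀ ρ k) - (Gt₀ ρ l * G ρ k - G ρ k * Gt₀ ρ l) = _
  rw [Gt₀_G_commutator, Gt₀_G_commutator, Wp_Gt₀_scaled_symm hρ k l]
  linear_combination (norm := module) (-(q + q⁻¹) * q * ρ) • Wm_Wp_symm ρ k l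

omit hρ in
theorem Wm_G₀_commutator_symm (k l : ℕ) :
    Wm ρ k * G₀ ρ (l + 1) - G₀ ρ (l + 1) * Wm ρ k =
      Wm ρ l * G₀ ρ (k + 1) - G₀ ρ (k + 1) * Wm ρ l := Wm_G_symm ρ k l

omit hρ in
theorem Wm_Gt₀_commutator_symm (k l : ℕ) :
    Wm ρ k * Gt₀ ρ (l + 1) - Gt₀ ρ (l + 1) * Wm ρ k =
      Wm ρ l * Gt₀ ρ (k + 1) - Gt₀ ρ (k + 1) * Wm ρ l := Wm_Gt_symm ρ k l

omit hρ in
theorem Wp_G₀_commutator_symm (k l : ℕ) :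
    Wp ρ k * G₀ ρ (l + 1) - G₀ ρ (l + 1) * Wp ρ k =
      Wp ρ l * G₀ ρ (k + 1) - G₀ ρ (k + 1) * Wp ρ l := Wp_G_symm ρ k l

theorem ser_G₀_mul_Wm (a b : F) :
    (q⁻¹ * (a - b)) • (ser (G₀ ρ) b * ser (Wm ρ) a) =
      (q⁻¹ * a - q * b) • (ser (Wm ρ) a * ser (G₀ ρ) b) +
        (b * (q - q⁻¹)) • (ser (Wm ρ) b * ser (G₀ ρ) a) :=
  mul_swap_of_symm (ser_symm _ _ _ _ a b (Wm_G₀_scaled_symm hρ))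
    (ser_symm_shift _ _ a b (G₀_zero_comm ρ) (Wm_G₀_commutator_symm))

theorem ser_Wp_mul_G₀ (a b : F) :
    (a - b) • (ser (Wp ρ) a * ser (G₀ ρ) b) =
      (a - q ^ 2 * b) • (ser (G₀ ρ) b * ser (Wp ρ) a) +
        (b * (q ^ 2 - 1)) • (ser (G₀ ρ) a * ser (Wp ρ) b) := by
  have hq := q_ne_zero
  have h := mul_of_symm (ser_symm _ _ _ _ a b (Wp_G₀_scaled_symm hρ))
    (ser_symm_shift _ _ a b (G₀_zero_comm ρ) (Wp_G₀_commutator_symm))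
  linear_combination (norm := skip) (-q) • h
  match_scalars <;> field_simp <;> ring

theorem ser_Wp_mul_G₀_inv :
    ser (Wp ρ) q * ser (G₀ ρ) q⁻¹ = ser (G₀ ρ) q * ser (Wp ρ) q⁻¹ := by
  have hq := q_ne_zero
  have h := ser_Wp_mul_G₀ hρ q q⁻¹
  have e₁ : q - q ^ 2 * q⁻¹ = 0 := by field_simp; ring
  have e₂ : q⁻¹ * (q ^ 2 - 1) = q - q⁻¹ := by field_simp
  rw [e₁, e₂, zero_smul, zero_add] at h
  exact smul_right_injective _ q_sub_inv_ne_zero h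

theorem ser_Gt₀_mul_Wm_inv :
    ser (Gt₀ ρ) q * ser (Wm ρ) q⁻¹ = ser (Wm ρ) q * ser (Gt₀ ρ) q⁻¹ := by
  have hq := q_ne_zero
  have h := mul_swap_of_symm (ser_symm _ _ _ _ q⁻¹ q (Wm_Gt₀_scaled_symm hρ))
    (ser_symm_shift _ _ q⁻¹ q (Gt₀_zero_comm ρ) (Wm_Gt₀_commutator_symm))
  have e₁ : -q * q⁻¹ - -q⁻¹ * q = 0 := by field_simp; ring
  have e₂ : q * (-q⁻¹ - -q) = -q * (q⁻¹ - q) := by ring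
  rw [e₁, e₂, zero_smul, zero_add] at h
  refine smul_right_injective _ (r := -q * (q⁻¹ - q)) ?_ h
  exact mul_ne_zero (neg_ne_zero.mpr hq) (sub_ne_zero.mpr (sub_ne_zero.mp q_sub_inv_ne_zero).symm)

end Relations

section Centrality

variable {ρ : F} (hρ : ρ ≠ 0)

variable (ρ) in
/-- The generating series of the central elements. -/
def centralSeries : PowerSeries (Aq ρ) :=
  ser (Gt₀ ρ) q * ser (G₀ ρ) q⁻¹ -
    (ρ * (q + q⁻¹)) • (PowerSeries.X * (ser (Wm ρ) q * ser (Wp ρ) q⁻¹))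

include hρ

theorem centralSeries_commute_ser_G₀ {s : F} (hs : s ≠ q) (hs' : s ≠ q⁻¹) :
    Commute (centralSeries ρ) (ser (G₀ ρ) s) := by
  have hq := q_ne_zero
  refine commute_of_exchange (Ms := ser (Wm ρ) s) (Ps := ser (Wp ρ) s) (gu := ser (G₀ ρ) q)
    (Pu := ser (Wp ρ) q) hq hs hs' ?_ ?_ (ser_Wp_mul_G₀_inv hρ) (ser_Wp_mul_G₀ hρ _ _) ?_
    (ser_commute _ _ _ _ (G₀_comm ρ)) (X_mul_series _)
  · exact ser_telescope _ _ _ _ q s _ (Gt₀_zero_comm ρ) (G₀_zero_comm ρ)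
      (Gt₀_G₀_antidiagonal_difference hρ)
  · rw [ser_Wp_mul_G₀ hρ]
    congr 2 <;> field_simp
  · rw [ser_G₀_mul_Wm hρ]
    congr 2
    field_simp

theorem centralSeries_commute_Wm_zero :
    Commute (centralSeries ρ) (PowerSeries.C (Wm ρ 0)) := by
  have hq := q_ne_zero
  refine commute_of_left_relations (Mv := ser (Wm ρ) q⁻¹) (hv := ser (Gt₀ ρ) q⁻¹) hq ?_ ?_ ?_
    (ser_Gt₀_mul_Wm_inv hρ) ?_ X_mul_series
  · ext n
    simp only [map_sub, coeff_smul_series, PowerSeries.coeff_C_mul, PowerSeries.coeff_mul_C,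
      coeff_ser, mul_smul_comm, smul_mul_assoc]
    linear_combination (norm := module) (q⁻¹ ^ n) • Wm_zero_G₀ ρ n
  · ext n
    simp only [map_sub, coeff_smul_series, PowerSeries.coeff_C_mul, PowerSeries.coeff_mul_C,
      coeff_ser, mul_smul_comm, smul_mul_assoc]
    linear_combination (norm := module) (q ^ n) • Gt₀_Wm_zero ρ n
  · ext n
    cases n with
    | zero =>
      simp only [coeff_smul_series, PowerSeries.coeff_zero_X_mul, map_sub, coeff_ser, smul_zero]
      simp [G₀, Gt₀]
    | succ n =>
      simp only [map_sub, coeff_smul_series, PowerSeries.coeff_succ_X_mul, PowerSeries.coeff_C_mul,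
        PowerSeries.coeff_mul_C, coeff_ser, mul_smul_comm, smul_mul_assoc, G₀,
        Gt₀]
      have h := congrArg ((q + q⁻¹) • ·) (Wm_zero_Wp ρ n)
      simp only [smul_inv_smul₀ q_add_inv_ne_zero] at h
      have e : q * q⁻¹ ^ (n + 1) = q⁻¹ ^ n := by rw [pow_succ', mul_inv_cancel_left₀ hq]
      linear_combination (norm := module) (q⁻¹ ^ n) • h - e • (Gt ρ n - G ρ n)
  · ext n
    simp only [PowerSeries.coeff_C_mul, PowerSeries.coeff_mul_C, coeff_ser, mul_smul_comm,
      smul_mul_assoc, Wm_comm]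

theorem centralSeries_commute_Wp_zero :
    Commute (centralSeries ρ) (PowerSeries.C (Wp ρ 0)) := by
  have hq := q_ne_zero
  refine commute_of_right_relations (Pu := ser (Wp ρ) q) (gu := ser (G₀ ρ) q) hq ?_ ?_ ?_
    (ser_Wp_mul_G₀_inv hρ) ?_ X_mul_series
  · ext n
    simp only [map_sub, coeff_smul_series, PowerSeries.coeff_C_mul, PowerSeries.coeff_mul_C,
      coeff_ser, mul_smul_comm, smul_mul_assoc]
    linear_combination (norm := module) (q⁻¹ ^ n) • G₀_Wp_zero ρ n
  · ext n
    simp only [map_sub, coeff_smul_series, PowerSeries.coeff_C_mul, PowerSeries.coeff_mul_C,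
      coeff_ser, mul_smul_comm, smul_mul_assoc]
    linear_combination (norm := module) (q ^ n) • Wp_zero_Gt₀ ρ n
  · ext n
    cases n with
    | zero =>
      simp only [coeff_smul_series, PowerSeries.coeff_zero_X_mul, map_sub, coeff_ser, smul_zero]
      simp [G₀, Gt₀]
    | succ n =>
      simp only [map_sub, coeff_smul_series, PowerSeries.coeff_succ_X_mul, PowerSeries.coeff_C_mul,
        PowerSeries.coeff_mul_C, coeff_ser, mul_smul_comm, smul_mul_assoc, G₀,
        Gt₀]
      have h := congrArg ((q + q⁻¹) • ·) (Wm_Wp_zero ρ n)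
      simp only [smul_inv_smul₀ q_add_inv_ne_zero] at h
      linear_combination (norm := skip) (q ^ n) • h
      match_scalars <;> field_simp <;> ring
  · ext n
    simp only [PowerSeries.coeff_C_mul, PowerSeries.coeff_mul_C, coeff_ser, mul_smul_comm,
      smul_mul_assoc, Wp_comm]

theorem coeff_centralSeries (n : ℕ) :
    PowerSeries.coeff (n + 1) (centralSeries ρ) = (ρ / (q - q⁻¹)) • Y ρ n := by
  have hq := q_ne_zero
  have hq' := q_sub_inv_ne_zero
  have pow_mul_inv_pow : ∀ i j : ℕ, q ^ i * q⁻¹ ^ j = q ^ ((i : ℤ) - j) := fun i j => by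
    rw [zpow_sub₀ hq, zpow_natCast, zpow_natCast, inv_pow, div_eq_mul_inv]
  have hW : PowerSeries.coeff n (ser (Wm ρ) q * ser (Wp ρ) q⁻¹) =
      ∑ k ∈ Finset.range (n + 1), q ^ (2 * (k : ℤ) - (n : ℤ)) • (Wm ρ k * Wp ρ (n - k)) := by
    rw [coeff_ser_mul, Finset.Nat.sum_antidiagonal_eq_sum_range_succ_mk]
    refine Finset.sum_congr rfl fun k hk => ?_
    have hk : k ≤ n := Finset.mem_range_succ_iff.mp hk
    rw [pow_mul_inv_pow]
    push_cast [hk]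
    congr 2
    ring
  have hG : PowerSeries.coeff (n + 1) (ser (Gt₀ ρ) q * ser (G₀ ρ) q⁻¹) =
      ∑ k ∈ Finset.range n, q ^ (2 * (k : ℤ) - (n : ℤ) + 1) • (Gt ρ k * G ρ (n - 1 - k)) +
        (ρ / (q - q⁻¹)) • (q ^ (-(n : ℤ) - 1) • G ρ n + q ^ ((n : ℤ) + 1) • Gt ρ n) := by
    rw [coeff_ser_mul, Finset.Nat.sum_antidiagonal_eq_sum_range_succ_mk, Finset.sum_range_succ,
      Finset.sum_range_succ', add_assoc]
    congr 1
    · refine Finset.sum_congr rfl fun k hk => ?_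
      have hk : k < n := Finset.mem_range.mp hk
      obtain ⟨m, rfl⟩ := Nat.exists_eq_add_of_lt hk
      have e₁ : k + m + 1 + 1 - (k + 1) = m + 1 := by omega
      have e₂ : k + m + 1 - 1 - k = m := by omega
      simp only [e₁, e₂]
      rw [pow_mul_inv_pow]
      push_cast
      refine congrArg₂ _ (congrArg _ ?_) rfl
      ring
    · rw [pow_mul_inv_pow, pow_mul_inv_pow, Nat.sub_self, Nat.sub_zero]
      dsimp only
      rw [← G₀_zero_comm ρ (Gt₀ ρ (n + 1))]
      change _ • (algebraMap F (Aq ρ) _ * G ρ n) + _ • (algebraMap F (Aq ρ) _ * Gt ρ n) = _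
      have e₁ : ((0 : ℕ) : ℤ) - ((n + 1 : ℕ) : ℤ) = -n - 1 := by push_cast; ring
      have e₂ : ((n + 1 : ℕ) : ℤ) - ((0 : ℕ) : ℤ) = n + 1 := by push_cast; ring
      rw [← Algebra.smul_def, ← Algebra.smul_def, e₁, e₂]
      module
  rw [centralSeries, map_sub, coeff_smul_series, PowerSeries.coeff_succ_X_mul, hW, hG, Y]
  have e₁ : ρ / (q - q⁻¹) * (q ^ (2 : ℤ) - q ^ (-2 : ℤ)) = ρ * (q + q⁻¹) := by
    rw [zpow_neg]
    norm_cast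
    rw [div_mul_eq_mul_div, div_eq_iff hq']
    field_simp
    ring
  have e₂ : ρ / (q - q⁻¹) * ((q - q⁻¹) / ρ) = 1 := by
    rw [div_mul_div_cancel₀ hq', div_self hρ]
  rw [smul_add (_ / _) (_ - _), smul_sub, smul_smul _ (_ - _), smul_smul _ (_ / _), e₁, e₂,
    one_smul]
  abel

theorem coeff_centralSeries_commute_G (n j : ℕ) :
    Commute (PowerSeries.coeff n (centralSeries ρ)) (G ρ j) := by
  have : Infinite F := CharZero.infinite F
  have H := eq_zero_of_sum_pow_smul (K := F) (n + (j + 1) + 1)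
    (fun i => PowerSeries.coeff (n + (j + 1) - i) (centralSeries ρ) * G₀ ρ i -
      G₀ ρ i * PowerSeries.coeff (n + (j + 1) - i) (centralSeries ρ)) {q, q⁻¹}
    (Set.toFinite _) (fun s hs => ?_) (j + 1) (by omega)
  · rw [Nat.add_sub_cancel] at H
    exact sub_eq_zero.mp H
  · rw [Set.mem_insert_iff, Set.mem_singleton_iff, not_or] at hs
    have h := congrArg (PowerSeries.coeff (n + (j + 1)))
      (centralSeries_commute_ser_G₀ hρ hs.1 hs.2).eq
    rw [PowerSeries.coeff_mul, PowerSeries.coeff_mul, ← Finset.Nat.sum_antidiagonal_swap,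
      Finset.Nat.sum_antidiagonal_eq_sum_range_succ_mk,
      Finset.Nat.sum_antidiagonal_eq_sum_range_succ_mk] at h
    simp only [Prod.swap, coeff_ser, mul_smul_comm, smul_mul_assoc] at h
    simp only [smul_sub, Finset.sum_sub_distrib]
    exact sub_eq_zero.mpr h

theorem coeff_centralSeries_central (n : ℕ) (x : Aq ρ) :
    Commute (PowerSeries.coeff n (centralSeries ρ)) x := by
  have hW : Commute (PowerSeries.coeff n (centralSeries ρ)) (Wm ρ 0) := by
    have := congrArg (PowerSeries.coeff n) (centralSeries_commute_Wm_zero hρ)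
    rwa [PowerSeries.coeff_C_mul, PowerSeries.coeff_mul_C] at this
  have hW' : Commute (PowerSeries.coeff n (centralSeries ρ)) (Wp ρ 0) := by
    have := congrArg (PowerSeries.coeff n) (centralSeries_commute_Wp_zero hρ)
    rwa [PowerSeries.coeff_C_mul, PowerSeries.coeff_mul_C] at this
  have hG := coeff_centralSeries_commute_G hρ n
  set y := PowerSeries.coeff n (centralSeries ρ)
  have hWm : ∀ k, Commute y (Wm ρ k) := by
    rintro (_ | k)
    · exact hW
    · have : Wm ρ (k + 1) = ρ⁻¹ • (q • (Wm ρ 0 * G ρ k) - q⁻¹ • (G ρ k * Wm ρ 0)) := by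
        rw [Wm_zero_G, inv_smul_smul₀ hρ]
      rw [this]
      exact (((hW.mul_right (hG k)).smul_right _).sub_right
        (((hG k).mul_right hW).smul_right _)).smul_right _
  have hWp : ∀ k, Commute y (Wp ρ k) := by
    rintro (_ | k)
    · exact hW'
    · have : Wp ρ (k + 1) = ρ⁻¹ • (q • (G ρ k * Wp ρ 0) - q⁻¹ • (Wp ρ 0 * G ρ k)) := by
        rw [G_Wp_zero, inv_smul_smul₀ hρ]
      rw [this]
      exact ((((hG k).mul_right hW').smul_right _).sub_right
        ((hW'.mul_right (hG k)).smul_right _)).smul_right _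
  have hGt : ∀ k, Commute y (Gt ρ k) := by
    intro k
    have : Gt ρ k = G ρ k + (q + q⁻¹) • (Wm ρ 0 * Wp ρ k - Wp ρ k * Wm ρ 0) := by
      rw [Wm_zero_Wp, smul_inv_smul₀ q_add_inv_ne_zero, add_sub_cancel]
    rw [this]
    exact (hG k).add_right
      (((hW.mul_right (hWp k)).sub_right ((hWp k).mul_right hW)).smul_right _)
  obtain ⟨x, rfl⟩ := RingQuot.mkAlgHom_surjective F (rel ρ) x
  induction x using FreeAlgebra.induction with
  | grade0 r => rw [AlgHom.commutes]; exact (Algebra.commutes r y).symm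
  | grade1 g =>
    cases g with
    | wm k => exact hWm k
    | wp k => exact hWp k
    | g k => exact hG k
    | gt k => exact hGt k
  | mul a b ha hb => rw [map_mul]; exact ha.mul_right hb
  | add a b ha hb => rw [map_add]; exact ha.add_right hb

end Centrality

/-- For every `n ∈ ℕ`, the element `Y_{n+1}` is central in `𝒜q`. -/
theorem statement3 (ρ : F) (hρ : ρ ≠ 0) (n : ℕ) (x : Aq ρ) :
    Y ρ n * x = x * Y ρ n := by
  have hc : ρ / (q - q⁻¹) ≠ 0 := div_ne_zero hρ q_sub_inv_ne_zero
  have h := coeff_centralSeries_central hρ (n + 1) x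
  rw [coeff_centralSeries hρ] at h
  simpa only [inv_smul_smul₀ hc] using (h.smul_left (ρ / (q - q⁻¹))⁻¹).eq

end Alt
end
end

section
/- The quotient algebra Āq = 𝒜q / (two-sided ideal generated by all Δ_{k+1}, k ∈ ℕ) is isomorphic as an F-algebra to U_q^{DJ,+}; an isomorphism is obtained by sending the image of W_0 to E_1 and the image of W_1 to E_0. -/
/- STATEMENT 8: Āq = 𝒜q/(Δ) is isomorphic to U_q^{DJ,+}, via W_0 ↦ E_1, W_1 ↦ E_0. -/

noncomputable section

namespace Alt

/-- The central element `Δ_{n+1} = (Y_{n+1} + σ(Y_{n+1}))/(q^{n+1} + q^{-n-1})`,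
for a given algebra automorphism `σ` of `𝒜q`. -/
def Δd (ρ : F) (σ : Aq ρ ≃ₐ[F] Aq ρ) (n : ℕ) : Aq ρ :=
  (q ^ ((n : ℤ) + 1) + q ^ (-(n : ℤ) - 1))⁻¹ • (Y ρ n + σ (Y ρ n))

/-- The relations `Δ_{n+1} = 0` defining the quotient `Āq`. -/
inductive relD (ρ : F) (σ : Aq ρ ≃ₐ[F] Aq ρ) : Aq ρ → Aq ρ → Prop
  | mk (n : ℕ) : relD ρ σ (Δd ρ σ n) 0

/-- The quotient `Āq` of `𝒜q` by the two-sided ideal generated by all `Δ_{k+1}`. -/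
abbrev Abar (ρ : F) (σ : Aq ρ ≃ₐ[F] Aq ρ) : Type := RingQuot (relD ρ σ)

/-- Generators of `U_q^{DJ,+}`. -/
inductive EGen : Type
  | e0 : EGen
  | e1 : EGen

/-- `E_0`, `E_1` in the free algebra. -/
def fE (i : EGen) : FreeAlgebra F EGen := FreeAlgebra.ι F i

/-- The `q`-Serre relations defining `U_q^{DJ,+}`. -/
inductive relE : FreeAlgebra F EGen → FreeAlgebra F EGen → Prop
  | s01 : relE (br (fE .e0) (qbr' (fE .e0) (qbr (fE .e0) (fE .e1)))) 0
  | s10 : relE (br (fE .e1) (qbr' (fE .e1) (qbr (fE .e1) (fE .e0)))) 0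

/-- The positive part `U_q^{DJ,+}` of `U_q(sl₂-hat)`, presented by `E_0, E_1`
and the `q`-Serre relations. -/
abbrev UqDJp : Type := RingQuot relE

/-- `E_0` in `U_q^{DJ,+}`. -/
def E0 : UqDJp := RingQuot.mkAlgHom F relE (fE .e0)
/-- `E_1` in `U_q^{DJ,+}`. -/
def E1 : UqDJp := RingQuot.mkAlgHom F relE (fE .e1)

namespace Half

section RootVectors
variable {K U : Type*} [Field K] [Ring U] [Algebra K U]

/-- The imaginary root vector `[b, a]_q`. -/
def psiOne (q : K) (a b : U) : U := q • (b * a) - q⁻¹ • (a * b)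

/-- The real root vectors obtained from `a` by iterating the adjoint action of `[b, a]_q`. -/
def xr (q r : K) (a b : U) : ℕ → U
  | 0 => a
  | n + 1 => r • (psiOne q a b * xr q r a b n - xr q r a b n * psiOne q a b)

/-- The real root vectors obtained from `b` by iterating the adjoint action of `[b, a]_q`. -/
def yr (q r : K) (a b : U) : ℕ → U
  | 0 => b
  | n + 1 => r • (yr q r a b n * psiOne q a b - psiOne q a b * yr q r a b n)

/-- The `q`-bracket `[y_i, x_j]_q` of real root vectors. -/
def yx (q r : K) (a b : U) (i j : ℕ) : U :=
  q • (yr q r a b i * xr q r a b j) - q⁻¹ • (xr q r a b j * yr q r a b i)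

/-- The imaginary root vectors. -/
def psi (q r : K) (a b : U) : ℕ → U
  | 0 => (r * (q ^ 2 - q⁻¹ ^ 2))⁻¹ • 1
  | n + 1 => yx q r a b 0 n

/-- The defect in the exchange relation between `x_{i+1}` and `x_j`. -/
def xxDefect (q r : K) (a b : U) (i j : ℕ) : U :=
  xr q r a b (i + 1) * xr q r a b j + xr q r a b (j + 1) * xr q r a b i -
    q ^ 2 • (xr q r a b j * xr q r a b (i + 1) + xr q r a b i * xr q r a b (j + 1))

/-- The defect in the exchange relation between `ψ_{k+1}` and `x_l`. -/
def psixDefect (q r : K) (a b : U) (k l : ℕ) : U :=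
  psi q r a b (k + 1) * xr q r a b l - xr q r a b l * psi q r a b (k + 1) -
    q ^ 2 • (psi q r a b k * xr q r a b (l + 1)) + q⁻¹ ^ 2 • (xr q r a b (l + 1) * psi q r a b k)

section
variable {q r : K} {a b : U}

theorem xxDefect_comm (i j : ℕ) : xxDefect q r a b i j = xxDefect q r a b j i := by
  simp only [xxDefect, smul_add]; abel

theorem xr_succ (n : ℕ) : xr q r a b (n + 1) =
    r • (psiOne q a b * xr q r a b n - xr q r a b n * psiOne q a b) := rfl

theorem yr_succ (n : ℕ) : yr q r a b (n + 1) =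
    r • (yr q r a b n * psiOne q a b - psiOne q a b * yr q r a b n) := rfl

theorem psi_one : psi q r a b 1 = psiOne q a b := rfl

theorem psi_zero : psi q r a b 0 = (r * (q ^ 2 - q⁻¹ ^ 2))⁻¹ • (1 : U) := rfl

theorem psiOne_bracket_xxDefect (i j : ℕ) :
    r • (psiOne q a b * xxDefect q r a b i j - xxDefect q r a b i j * psiOne q a b) =
      xxDefect q r a b (i + 1) j + xxDefect q r a b i (j + 1) := by
  simp only [xxDefect, xr_succ, mul_add, add_mul, mul_sub, sub_mul, smul_mul_assoc, mul_smul_comm,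
    smul_smul, smul_add, smul_sub, mul_assoc]
  match_scalars <;> ring

theorem psiOne_bracket_yx (i j : ℕ) :
    r • (psiOne q a b * yx q r a b i j - yx q r a b i j * psiOne q a b) =
      yx q r a b i (j + 1) - yx q r a b (i + 1) j := by
  simp only [yx, xr_succ, yr_succ, mul_sub, sub_mul, smul_mul_assoc,
    mul_smul_comm, smul_smul, smul_sub, mul_assoc]
  match_scalars <;> ring

theorem psixDefect_zero (hr : r ≠ 0) (hd : q ^ 2 - q⁻¹ ^ 2 ≠ 0) (l : ℕ) :
    psixDefect q r a b 0 l = 0 := by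
  have he := mul_inv_cancel₀ (mul_ne_zero hr hd)
  rw [psixDefect, psi_zero]
  generalize (r * (q ^ 2 - q⁻¹ ^ 2))⁻¹ = e at he ⊢
  simp only [zero_add, psi_one, xr_succ, mul_sub,
    smul_mul_assoc, mul_smul_comm, smul_smul, smul_sub, one_mul, mul_one]
  match_scalars
  · linear_combination -he
  · linear_combination he

/-- The Serre relation is the exchange relation between `x_1` and `x_0`. -/
theorem xxDefect_zero_zero (hq : q ≠ 0)
    (h : b * a * a * a - (q ^ 2 + 1 + q⁻¹ ^ 2) • (a * b * a * a) +
      (q ^ 2 + 1 + q⁻¹ ^ 2) • (a * a * b * a) - a * a * a * b = 0) :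
    xxDefect q r a b 0 0 = 0 := by
  have h' : xxDefect q r a b 0 0 = (2 * r * q) • (b * a * a * a -
      (q ^ 2 + 1 + q⁻¹ ^ 2) • (a * b * a * a) +
      (q ^ 2 + 1 + q⁻¹ ^ 2) • (a * a * b * a) - a * a * a * b) := by
    simp only [xxDefect, xr, psiOne, mul_add, mul_sub, sub_mul,
      smul_mul_assoc, mul_smul_comm, smul_smul, smul_add, smul_sub, mul_assoc]
    match_scalars <;> field_simp <;> ring
  rw [h', h, smul_zero]

/-- Commuting `y_n` past the exchange relation of the `x_m`. -/
theorem psixDefect_add_psixDefect (hq : q ≠ 0) (n m l : ℕ)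
    (hR : xxDefect q r a b m l = 0)
    (h1 : yx q r a b n m = psi q r a b (n + m + 1))
    (h2 : yx q r a b n l = psi q r a b (n + l + 1))
    (h3 : yx q r a b n (m + 1) = psi q r a b (n + m + 2))
    (h4 : yx q r a b n (l + 1) = psi q r a b (n + l + 2)) :
    psixDefect q r a b (n + m + 1) l + psixDefect q r a b (n + l + 1) m = 0 := by
  have key : psixDefect q r a b (n + m + 1) l + psixDefect q r a b (n + l + 1) m =
      q • (yr q r a b n * xxDefect q r a b m l) -
        q⁻¹ ^ 3 • (xxDefect q r a b m l * yr q r a b n) := by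
    simp only [psixDefect, add_assoc, one_add_one_eq_two]
    simp only [← add_assoc]
    rw [← h1, ← h2, ← h3, ← h4]
    simp only [yx, xxDefect, mul_add, add_mul, mul_sub, sub_mul,
      smul_mul_assoc, mul_smul_comm, smul_smul, smul_add, smul_sub, mul_assoc]
    match_scalars <;> field_simp <;> ring
  rw [key, hR]; simp

/-- The relations `[y_i, x_j]_q = ψ_{i+j+1}` up to level `n`. -/
def LevelC (q r : K) (a b : U) (n : ℕ) : Prop :=
  ∀ i j, i + j + 1 ≤ n → yx q r a b i j = psi q r a b (i + j + 1)

/-- The exchange relations among the `x_i` up to level `n`. -/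
def LevelR (q r : K) (a b : U) (n : ℕ) : Prop :=
  ∀ i j, i + j + 2 ≤ n → xxDefect q r a b i j = 0

theorem psixDefect_eq_zero (hr : r ≠ 0) (hq : q ≠ 0) (hd : q ^ 2 - q⁻¹ ^ 2 ≠ 0) (h2 : (2 : K) ≠ 0)
    {n : ℕ} (hC : LevelC q r a b n) (hR : LevelR q r a b n) {k l : ℕ} (hkl : k + l + 1 ≤ n) :
    psixDefect q r a b k l = 0 := by
  have base : ∀ k, k + 1 ≤ n → psixDefect q r a b k 0 = 0 := by
    intro k hk
    rcases k with - | k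
    · exact psixDefect_zero hr hd 0
    · have h := psixDefect_add_psixDefect (r := r) (a := a) (b := b) hq k 0 0
        (hR _ _ (by omega)) (hC _ _ (by omega)) (hC _ _ (by omega)) (hC k (0 + 1) (by omega))
        (hC k (0 + 1) (by omega))
      rw [← two_smul K] at h
      exact (smul_eq_zero.1 h).resolve_left h2
  rcases k with - | k
  · exact psixDefect_zero hr hd l
  · have h := psixDefect_add_psixDefect (r := r) (a := a) (b := b) hq k 0 l
      (hR _ _ (by omega)) (hC _ _ (by omega)) (hC _ _ (by omega)) (hC k (0 + 1) (by omega))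
      (hC k (l + 1) (by omega))
    rw [base (k + l + 1) (by omega), add_zero] at h
    exact h

/-- The bracket with `2ψ_2 - (r (q² - q⁻²)) ψ_1²` shifts the index of `x_l` by two. -/
theorem psiTwo_bracket_xr (hr : r ≠ 0) (hq : q ≠ 0) {l : ℕ}
    (h0 : psixDefect q r a b 1 l = 0) (z : U)
    (hz : z = (2 : K) • psi q r a b 2 - (r * (q ^ 2 - q⁻¹ ^ 2)) • (psiOne q a b * psiOne q a b)) :
    z * xr q r a b l - xr q r a b l * z =
      (r⁻¹ * (q ^ 2 + q⁻¹ ^ 2)) • xr q r a b (l + 2) := by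
  have e : ((2 : K)) • psixDefect q r a b 1 l = 0 := by rw [h0, smul_zero]
  rw [← sub_eq_zero, ← e]
  simp only [hz, psixDefect, psi_one, xr_succ, mul_add, add_mul, mul_sub, sub_mul,
    smul_mul_assoc, mul_smul_comm, smul_smul, smul_add, smul_sub, mul_assoc]
  match_scalars <;> field_simp <;> ring

theorem bracket_xxDefect {z : U} {c : K} {i j : ℕ}
    (hi : z * xr q r a b i - xr q r a b i * z = c • xr q r a b (i + 2))
    (hi' : z * xr q r a b (i + 1) - xr q r a b (i + 1) * z = c • xr q r a b (i + 2 + 1))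
    (hj : z * xr q r a b j - xr q r a b j * z = c • xr q r a b (j + 2))
    (hj' : z * xr q r a b (j + 1) - xr q r a b (j + 1) * z = c • xr q r a b (j + 2 + 1)) :
    z * xxDefect q r a b i j - xxDefect q r a b i j * z =
      c • (xxDefect q r a b (i + 2) j + xxDefect q r a b i (j + 2)) := by
  rw [sub_eq_iff_eq_add] at hi hi' hj hj'
  simp only [xxDefect, mul_add, mul_sub, mul_smul_comm, ← mul_assoc, hi, hi', hj, hj', add_mul,
    smul_mul_assoc]
  simp only [mul_assoc, hi, hi', hj, hj', mul_add, sub_mul, add_mul,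
    smul_mul_assoc, mul_smul_comm, smul_smul, smul_add, smul_sub]
  match_scalars <;> ring

theorem LevelR.succ (hr : r ≠ 0) (hq : q ≠ 0) (hd : q ^ 2 - q⁻¹ ^ 2 ≠ 0)
    (hd' : q ^ 2 + q⁻¹ ^ 2 ≠ 0) (h2 : (2 : K) ≠ 0) (h00 : xxDefect q r a b 0 0 = 0)
    {n : ℕ} (hC : LevelC q r a b n) (hR : LevelR q r a b n) : LevelR q r a b (n + 1) := by
  have shiftOne : ∀ i j, i + j + 2 ≤ n →
      xxDefect q r a b (i + 1) j + xxDefect q r a b i (j + 1) = 0 := by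
    intro i j hij
    rw [← psiOne_bracket_xxDefect, hR i j hij]
    simp
  have shiftTwo : ∀ i j, i + j + 3 ≤ n →
      xxDefect q r a b (i + 2) j + xxDefect q r a b i (j + 2) = 0 := by
    intro i j hij
    have hx := fun l (hl : l + 2 ≤ n) => psiTwo_bracket_xr hr hq
      (psixDefect_eq_zero hr hq hd h2 hC hR (k := 1) (l := l) (by omega)) _ rfl
    have h := bracket_xxDefect (hx i (by omega)) (hx (i + 1) (by omega)) (hx j (by omega))
      (hx (j + 1) (by omega))
    rw [hR i j (by omega), mul_zero, zero_mul, sub_zero] at h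
    exact (smul_eq_zero.1 h.symm).resolve_left (mul_ne_zero (inv_ne_zero hr) hd')
  have two : ∀ z : U, z + z = 0 → z = 0 := by
    intro z hz
    rw [← two_smul K] at hz
    exact (smul_eq_zero.1 hz).resolve_left h2
  have high : ∀ i j, i + 2 + j + 2 ≤ n + 1 → xxDefect q r a b (i + 2) j = 0 := by
    intro i j hij
    have e1 := shiftOne (i + 1) j (by omega)
    have e2 := shiftOne i (j + 1) (by omega)
    have e3 := shiftTwo i j (by omega)
    apply two
    have : xxDefect q r a b (i + 2) j + xxDefect q r a b (i + 2) j =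
      (xxDefect q r a b (i + 1 + 1) j + xxDefect q r a b (i + 1) (j + 1)) -
      (xxDefect q r a b (i + 1) (j + 1) + xxDefect q r a b i (j + 1 + 1)) +
      (xxDefect q r a b (i + 2) j + xxDefect q r a b i (j + 2)) := by abel
    rw [this, e1, e2, e3]; simp
  intro i j hij
  rcases i with - | - | i
  · rcases j with - | - | j
    · exact h00
    · have h := shiftOne 0 0 (by omega)
      rw [xxDefect_comm] at h
      exact two _ h
    · rw [xxDefect_comm]
      exact high j 0 (by omega)
  · rcases j with - | - | j
    · have h := shiftOne 0 0 (by omega)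
      rw [xxDefect_comm 0] at h
      exact two _ h
    · have h := shiftOne 1 0 (by omega)
      rwa [high 0 0 (by omega), zero_add] at h
    · rw [xxDefect_comm]
      exact high j 1 (by omega)
  · exact high i j hij

/-- The defect in the exchange relation between `ψ_{k+1}` and `y_l`. -/
def psiyDefect (q r : K) (a b : U) (k l : ℕ) : U :=
  yr q r a b l * psi q r a b (k + 1) - psi q r a b (k + 1) * yr q r a b l -
    q ^ 2 • (yr q r a b (l + 1) * psi q r a b k) + q⁻¹ ^ 2 • (psi q r a b k * yr q r a b (l + 1))

theorem psi_yx_exchange (hq : q ≠ 0) {k l m : ℕ}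
    (h1 : psixDefect q r a b (k + 1) l = 0) (h2 : psixDefect q r a b k l = 0)
    (h3 : psiyDefect q r a b (k + 1) m = 0) (h4 : psiyDefect q r a b k m = 0) :
    (psi q r a b (k + 2) * yx q r a b m l - yx q r a b m l * psi q r a b (k + 2)) -
      (q ^ 2 • (psi q r a b (k + 1) * yx q r a b m (l + 1)) -
        q⁻¹ ^ 2 • (yx q r a b m (l + 1) * psi q r a b (k + 1))) -
      (q⁻¹ ^ 2 • (psi q r a b (k + 1) * yx q r a b (m + 1) l) -
        q ^ 2 • (yx q r a b (m + 1) l * psi q r a b (k + 1))) +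
      (psi q r a b k * yx q r a b (m + 1) (l + 1) -
        yx q r a b (m + 1) (l + 1) * psi q r a b k) = 0 := by
  have e : q • (-(psiyDefect q r a b (k + 1) m * xr q r a b l) +
        q ^ 2 • (psiyDefect q r a b k m * xr q r a b (l + 1)) +
        yr q r a b m * psixDefect q r a b (k + 1) l -
        q ^ 2 • (yr q r a b (m + 1) * psixDefect q r a b k l)) -
      q⁻¹ • (psixDefect q r a b (k + 1) l * yr q r a b m -
        q⁻¹ ^ 2 • (psixDefect q r a b k l * yr q r a b (m + 1)) -
        xr q r a b l * psiyDefect q r a b (k + 1) m +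
        q⁻¹ ^ 2 • (xr q r a b (l + 1) * psiyDefect q r a b k m)) = 0 := by
    rw [h1, h2, h3, h4]; simp
  rw [← e]
  simp only [psixDefect, psiyDefect, yx, mul_add, add_mul, mul_sub, sub_mul,
    smul_mul_assoc, mul_smul_comm, smul_smul, smul_add, smul_sub, mul_assoc, smul_neg]
  match_scalars <;> field_simp <;> ring

variable {S : U →ₗ[K] U}

theorem map_psiOne (hS : ∀ x y, S (x * y) = S y * S x) (ha : S a = b) (hb : S b = a) :
    S (psiOne q a b) = psiOne q a b := by
  simp [psiOne, hS, ha, hb]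

theorem map_xr (hS : ∀ x y, S (x * y) = S y * S x) (ha : S a = b) (hb : S b = a) (n : ℕ) :
    S (xr q r a b n) = yr q r a b n := by
  induction n with
  | zero => exact ha
  | succ n ih => simp [xr_succ, yr_succ, hS, ih, map_psiOne hS ha hb]

theorem map_yr (hS : ∀ x y, S (x * y) = S y * S x) (ha : S a = b) (hb : S b = a) (n : ℕ) :
    S (yr q r a b n) = xr q r a b n := by
  induction n with
  | zero => exact hb
  | succ n ih => simp [xr_succ, yr_succ, hS, ih, map_psiOne hS ha hb]

theorem map_yx (hS : ∀ x y, S (x * y) = S y * S x) (ha : S a = b) (hb : S b = a) (i j : ℕ) :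
    S (yx q r a b i j) = yx q r a b j i := by
  simp [yx, hS, map_xr hS ha hb, map_yr hS ha hb]

theorem LevelC.map_psi (hS : ∀ x y, S (x * y) = S y * S x) (ha : S a = b) (hb : S b = a)
    (h1 : S 1 = 1) {n : ℕ} (hC : LevelC q r a b n) {k : ℕ} (hk : k ≤ n) :
    S (psi q r a b k) = psi q r a b k := by
  rcases k with - | k
  · simp [psi_zero, h1]
  · rw [psi, map_yx hS ha hb, hC k 0 (by omega), add_zero, psi]

theorem psiyDefect_eq_zero (hS : ∀ x y, S (x * y) = S y * S x) (ha : S a = b) (hb : S b = a)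
    (h1 : S 1 = 1) {n : ℕ} (hC : LevelC q r a b n) {k l : ℕ} (hk : k + 1 ≤ n)
    (hx : psixDefect q r a b k l = 0) : psiyDefect q r a b k l = 0 := by
  have h := congrArg S hx
  simpa [psixDefect, psiyDefect, hS, map_xr hS ha hb, hC.map_psi hS ha hb h1 hk,
    hC.map_psi hS ha hb h1 (k.le_succ.trans hk)] using h

/-- `q` is nonzero and not a root of unity, in characteristic other than two. -/
structure IsGeneric (q : K) : Prop where
  ne_zero : q ≠ 0
  two_ne_zero : (2 : K) ≠ 0
  pow_ne_one : ∀ n, 0 < n → q ^ n ≠ 1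

theorem IsGeneric.sub_ne_zero (hq : IsGeneric q) {n : ℕ} (hn : 0 < n) :
    q ^ n - q⁻¹ ^ n ≠ 0 := by
  intro h
  apply hq.pow_ne_one (n + n) (by omega)
  rw [pow_add]
  nth_rewrite 1 [sub_eq_zero.1 h]
  rw [← mul_pow, inv_mul_cancel₀ hq.ne_zero, one_pow]

theorem IsGeneric.add_ne_zero (hq : IsGeneric q) (n : ℕ) : q ^ n + q⁻¹ ^ n ≠ 0 := by
  intro h
  rcases n.eq_zero_or_pos with rfl | hn
  · apply hq.two_ne_zero
    rw [← h]; norm_num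
  · apply hq.pow_ne_one (n + n + (n + n)) (by omega)
    have : q ^ (n + n) = -1 := by
      rw [pow_add]
      nth_rewrite 1 [eq_neg_of_add_eq_zero_left h]
      rw [neg_mul, ← mul_pow, inv_mul_cancel₀ hq.ne_zero, one_pow]
    rw [pow_add, this]; norm_num

theorem LevelC.smul_bracket_psi (hq : IsGeneric q) (hr : r ≠ 0)
    (hS : ∀ x y, S (x * y) = S y * S x) (ha : S a = b) (hb : S b = a)
    (h1 : S 1 = 1) {n : ℕ} (hC : LevelC q r a b n) (hR : LevelR q r a b n) (k : ℕ) (hk : k ≤ n) :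
    (q ^ 2 - q⁻¹ ^ 2) • (psi q r a b k * psi q r a b (n + 1 - k) -
      psi q r a b (n + 1 - k) * psi q r a b k) = (q ^ (2 * k) - q⁻¹ ^ (2 * k)) •
      (psi q r a b 1 * psi q r a b n - psi q r a b n * psi q r a b 1) := by
  have hd := hq.sub_ne_zero two_pos
  induction k using Nat.twoStepInduction with
  | zero => simp [psi_zero]
  | one => simp
  | more k ih1 ih2 =>
    have ih1 := ih1 (by omega)
    have ih2 := ih2 (by omega)
    obtain ⟨m, rfl⟩ := Nat.exists_eq_add_of_le hk
    have hx : ∀ k' l, k' + l + 1 ≤ k + 2 + m → psixDefect q r a b k' l = 0 := fun k' l h =>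
      psixDefect_eq_zero hr hq.ne_zero hd hq.two_ne_zero hC hR h
    have hy : ∀ k' l, k' + l + 1 ≤ k + 2 + m → psiyDefect q r a b k' l = 0 := fun k' l h =>
      psiyDefect_eq_zero hS ha hb h1 hC (by omega) (hx k' l h)
    have e := psi_yx_exchange hq.ne_zero (hx (k + 1) 0 (by omega)) (hx k 0 (by omega))
      (hy (k + 1) m (by omega)) (hy k m (by omega))
    have e4 : psi q r a b k * yx q r a b (m + 1) (0 + 1) -
        yx q r a b (m + 1) (0 + 1) * psi q r a b k =
        psi q r a b k * psi q r a b (m + 3) - psi q r a b (m + 3) * psi q r a b k := by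
      rcases k with - | k
      · simp [psi_zero]
      · rw [hC (m + 1) (0 + 1) (by omega)]
    rw [e4, hC m 0 (by omega), hC m (0 + 1) (by omega), hC (m + 1) 0 (by omega)] at e
    rw [show k + 2 + m + 1 - k = m + 3 by omega] at ih1
    rw [show k + 2 + m + 1 - (k + 1) = m + 2 by omega] at ih2
    rw [show k + 2 + m + 1 - (k + 2) = m + 1 by omega]
    simp only [add_zero, zero_add] at e
    have e' : psi q r a b (k + 2) * psi q r a b (m + 1) -
        psi q r a b (m + 1) * psi q r a b (k + 2) =
        (q ^ 2 + q⁻¹ ^ 2) • (psi q r a b (k + 1) * psi q r a b (m + 2) -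
          psi q r a b (m + 2) * psi q r a b (k + 1)) -
        (psi q r a b k * psi q r a b (m + 3) - psi q r a b (m + 3) * psi q r a b k) := by
      rw [← sub_eq_zero, ← e]
      module
    rw [e', smul_sub, smul_comm, ih1, ih2, smul_smul, ← sub_smul]
    congr 1
    have hv : q ^ 2 * q⁻¹ ^ 2 = 1 := by rw [← mul_pow, mul_inv_cancel₀ hq.ne_zero, one_pow]
    generalize q⁻¹ = v at hv ⊢
    linear_combination (q ^ (2 * k) - v ^ (2 * k)) * hv

theorem LevelC.bracket_psi_one (hq : IsGeneric q) (hr : r ≠ 0)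
    (hS : ∀ x y, S (x * y) = S y * S x) (ha : S a = b) (hb : S b = a)
    (h1 : S 1 = 1) {n : ℕ} (hC : LevelC q r a b n) (hR : LevelR q r a b n) :
    psi q r a b 1 * psi q r a b n - psi q r a b n * psi q r a b 1 = 0 := by
  rcases n with - | k
  · simp [psi_zero]
  have h := hC.smul_bracket_psi hq hr hS ha hb h1 hR (k + 1) le_rfl
  rw [show k + 1 + 1 - (k + 1) = 1 by omega] at h
  have h' : ((q ^ (k + 2) - q⁻¹ ^ (k + 2)) * (q ^ k + q⁻¹ ^ k)) •
      (psi q r a b 1 * psi q r a b (k + 1) - psi q r a b (k + 1) * psi q r a b 1) = 0 := by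
    have e : (q ^ (k + 2) - q⁻¹ ^ (k + 2)) * (q ^ k + q⁻¹ ^ k) =
        (q ^ (2 * (k + 1)) - q⁻¹ ^ (2 * (k + 1))) + (q ^ 2 - q⁻¹ ^ 2) := by
      have hv : q ^ k * q⁻¹ ^ k = 1 := by rw [← mul_pow, mul_inv_cancel₀ hq.ne_zero, one_pow]
      generalize q⁻¹ = v at hv ⊢
      linear_combination (q ^ 2 - v ^ 2) * hv
    rw [e, add_smul, ← h]
    module
  exact (smul_eq_zero.1 h').resolve_left
    (mul_ne_zero (hq.sub_ne_zero (by omega)) (hq.add_ne_zero k))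

theorem LevelC.succ (hq : IsGeneric q) (hr : r ≠ 0)
    (hS : ∀ x y, S (x * y) = S y * S x) (ha : S a = b) (hb : S b = a)
    (h1 : S 1 = 1) {n : ℕ} (hC : LevelC q r a b n) (hR : LevelR q r a b n) :
    LevelC q r a b (n + 1) := by
  have shift : ∀ i j, i + j + 1 = n → yx q r a b (i + 1) j = yx q r a b i (j + 1) := by
    intro i j hij
    have h := psiOne_bracket_yx (q := q) (r := r) (a := a) (b := b) i j
    rw [hC i j (by omega), hij, ← psi_one (q := q) (r := r),
      hC.bracket_psi_one hq hr hS ha hb h1 hR, smul_zero] at h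
    exact (sub_eq_zero.1 h.symm).symm
  intro i j hij
  rcases hij.lt_or_eq with hlt | heq
  · exact hC i j (by omega)
  · induction i generalizing j with
    | zero => rw [zero_add]; rfl
    | succ i ih => rw [shift i j (by omega), ih (j + 1) (by omega) (by omega)]; congr 1; omega

section Final
variable (hq : IsGeneric q) (hr : r ≠ 0)
    (hS : ∀ x y, S (x * y) = S y * S x) (ha : S a = b) (hb : S b = a) (h1 : S 1 = 1)
    (h00 : xxDefect q r a b 0 0 = 0)
include hq hr hS ha hb h1 h00

theorem levelC_and_levelR (n : ℕ) : LevelC q r a b n ∧ LevelR q r a b n := by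
  induction n with
  | zero => exact ⟨fun i j h => absurd h (by omega), fun i j h => absurd h (by omega)⟩
  | succ n ih => exact ⟨ih.1.succ hq hr hS ha hb h1 ih.2,
      ih.2.succ hr hq.ne_zero (hq.sub_ne_zero two_pos) (hq.add_ne_zero 2) hq.two_ne_zero h00 ih.1⟩

theorem yx_eq_psi (i j : ℕ) : yx q r a b i j = psi q r a b (i + j + 1) :=
  (levelC_and_levelR hq hr hS ha hb h1 h00 _).1 i j le_rfl

theorem xxDefect_eq (i j : ℕ) : xxDefect q r a b i j = 0 :=
  (levelC_and_levelR hq hr hS ha hb h1 h00 _).2 i j le_rfl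

theorem psixDefect_eq (k l : ℕ) : psixDefect q r a b k l = 0 :=
  have h := levelC_and_levelR hq hr hS ha hb h1 h00 (k + l + 1)
  psixDefect_eq_zero hr hq.ne_zero (hq.sub_ne_zero two_pos) hq.two_ne_zero h.1 h.2 le_rfl

theorem map_psi (k : ℕ) : S (psi q r a b k) = psi q r a b k :=
  (levelC_and_levelR hq hr hS ha hb h1 h00 k).1.map_psi hS ha hb h1 le_rfl

theorem psi_commute (k l : ℕ) : Commute (psi q r a b k) (psi q r a b l) := by
  rcases l with - | l
  · rw [psi_zero]; exact (Commute.one_right _).smul_right _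
  have h := levelC_and_levelR hq hr hS ha hb h1 h00 (k + l)
  have e := h.1.smul_bracket_psi hq hr hS ha hb h1 h.2 k (by omega)
  rw [h.1.bracket_psi_one hq hr hS ha hb h1 h.2, smul_zero,
    show k + l + 1 - k = l + 1 by omega] at e
  exact sub_eq_zero.1 ((smul_eq_zero.1 e).resolve_left (hq.sub_ne_zero two_pos))

end Final
end
end RootVectors

open PowerSeries Finset

section Dilation
variable {K U : Type*} [Field K] [Ring U] [Algebra K U]

/-- The substitution `t ↦ ct` in a power series. -/
def dil (c : K) (f : PowerSeries U) : PowerSeries U := .mk fun n => c ^ n • coeff n f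

@[simp] theorem coeff_dil (c : K) (f : PowerSeries U) (n : ℕ) :
    coeff n (dil c f) = c ^ n • coeff n f := by simp [dil]

theorem dil_mul (c : K) (f g : PowerSeries U) : dil c (f * g) = dil c f * dil c g := by
  ext n
  simp only [coeff_dil, coeff_mul, smul_sum]
  refine sum_congr rfl fun p hp => ?_
  rw [smul_mul_smul_comm, ← pow_add, mem_antidiagonal.1 hp]

theorem dil_add (c : K) (f g : PowerSeries U) : dil c (f + g) = dil c f + dil c g := by
  ext n; simp

theorem dil_sub (c : K) (f g : PowerSeries U) : dil c (f - g) = dil c f - dil c g := by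
  ext n; simp [smul_sub]

theorem dil_smul (c d : K) (f : PowerSeries U) : dil c (d • f) = d • dil c f := by
  ext n; simp [smul_smul, mul_comm]

theorem dil_dil (c d : K) (f : PowerSeries U) : dil c (dil d f) = dil (c * d) f := by
  ext n; simp [smul_smul, mul_pow]

theorem dil_one (f : PowerSeries U) : dil (1 : K) f = f := by
  ext n; simp

theorem coeff_mul_of_lt_left {f g : PowerSeries U} {n : ℕ} (hf : ∀ m < n, coeff m f = 0) :
    coeff n (f * g) = coeff n f * coeff 0 g := by
  rw [coeff_mul, sum_eq_single (n, 0)]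
  · rintro ⟨i, j⟩ hp hne
    have hp' := mem_antidiagonal.1 hp
    rw [hf i (by
      rcases j with - | j
      · exact absurd (by simpa using hp') hne
      · simp only at hp'; omega), zero_mul]
  · intro h; exact absurd (HasAntidiagonal.mem_antidiagonal.2 (by simp)) h

theorem coeff_mul_of_lt_right {f g : PowerSeries U} {n : ℕ} (hg : ∀ m < n, coeff m g = 0) :
    coeff n (f * g) = coeff 0 f * coeff n g := by
  rw [coeff_mul, sum_eq_single (0, n)]
  · rintro ⟨i, j⟩ hp hne
    have hp' := mem_antidiagonal.1 hp
    rw [hg j (by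
      rcases i with - | i
      · exact absurd (by simpa using hp') hne
      · simp only at hp'; omega), mul_zero]
  · intro h; exact absurd (HasAntidiagonal.mem_antidiagonal.2 (by simp)) h

theorem coeff_mul_eq_zero_of_lt_left {f g : PowerSeries U} {n : ℕ}
    (hf : ∀ m < n, coeff m f = 0) (m : ℕ) (hm : m < n) : coeff m (f * g) = 0 := by
  rw [coeff_mul_of_lt_left fun k hk => hf k (hk.trans hm), hf m hm, zero_mul]

theorem coeff_mul_eq_zero_of_lt_right {f g : PowerSeries U} {n : ℕ}
    (hg : ∀ m < n, coeff m g = 0) (m : ℕ) (hm : m < n) : coeff m (f * g) = 0 := by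
  rw [coeff_mul_of_lt_right fun k hk => hg k (hk.trans hm), hg m hm, mul_zero]

theorem coeff_zero_mul_coeff (f g : PowerSeries U) :
    coeff 0 (f * g) = coeff 0 f * coeff 0 g := by
  rw [coeff_mul, Finset.Nat.antidiagonal_zero, sum_singleton]

end Dilation

section Sqrt
variable {K U : Type*} [Field K] [Ring U] [Algebra K U]

/-- Truncations of the solution `G(t)` of `ψ(t) G(qt) G(q⁻¹t) = ψ(0) G(0)²`. -/
def trunc (q e g : K) (p : ℕ → U) : ℕ → ℕ → U
  | 0 => Function.update 0 0 (g • 1)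
  | n + 1 => Function.update (trunc q e g p n) (n + 1)
      (-(e * g * (q ^ (n + 1) + q⁻¹ ^ (n + 1)))⁻¹ •
        coeff (n + 1) (.mk p * (dil q (.mk (trunc q e g p n)) * dil q⁻¹ (.mk (trunc q e g p n)))))

/-- The coefficients of the solution `G(t)` of `ψ(t) G(qt) G(q⁻¹t) = ψ(0) G(0)²`. -/
def gSeq (q e g : K) (p : ℕ → U) (n : ℕ) : U := trunc q e g p n n

variable {q e g : K} {p : ℕ → U}

theorem trunc_of_lt {n m : ℕ} (h : n < m) : trunc q e g p n m = 0 := by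
  induction n with
  | zero => rw [trunc, Function.update_of_ne (by omega)]; rfl
  | succ n ih => rw [trunc, Function.update_of_ne (by omega), ih (by omega)]

theorem trunc_of_le {n m : ℕ} (h : m ≤ n) : trunc q e g p n m = gSeq q e g p m := by
  induction n, h using Nat.le_induction with
  | base => rfl
  | succ n hn ih => rw [trunc, Function.update_of_ne (by omega), ih]

theorem gSeq_zero : gSeq q e g p 0 = g • (1 : U) := by simp [gSeq, trunc]

theorem gSeq_succ (n : ℕ) : gSeq q e g p (n + 1) =
    -(e * g * (q ^ (n + 1) + q⁻¹ ^ (n + 1)))⁻¹ •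
      coeff (n + 1) (.mk p * (dil q (.mk (trunc q e g p n)) *
        dil q⁻¹ (.mk (trunc q e g p n)))) := by
  simp [gSeq, trunc]

theorem coeff_mem {A : Subalgebra K U} {f h : PowerSeries U} (hf : ∀ n, coeff n f ∈ A)
    (hh : ∀ n, coeff n h ∈ A) (n : ℕ) : coeff n (f * h) ∈ A := by
  rw [coeff_mul]
  exact A.sum_mem fun i _ => A.mul_mem (hf _) (hh _)

theorem gSeq_mem {A : Subalgebra K U} (hp : ∀ n, p n ∈ A) (n : ℕ) : gSeq q e g p n ∈ A := by
  have key : ∀ n m, trunc q e g p n m ∈ A := by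
    intro n
    induction n with
    | zero =>
      intro m
      by_cases hm : m = 0
      · subst hm; simp [trunc, A.smul_mem A.one_mem g]
      · simp [trunc, Function.update_of_ne hm]
    | succ n ih =>
      intro m
      by_cases hm : m = n + 1
      · subst hm
        rw [trunc, Function.update_self]
        refine A.smul_mem (coeff_mem (by simp [hp]) (coeff_mem ?_ ?_) _) _
        all_goals intro k; rw [coeff_dil, coeff_mk]; exact A.smul_mem (ih _) _
      · rw [trunc, Function.update_of_ne hm]; exact ih m
  exact key n n

theorem coeff_smul_one (c : K) (n : ℕ) :
    coeff n (c • (1 : PowerSeries U)) = if n = 0 then c • 1 else 0 := by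
  rw [PowerSeries.coeff_smul, coeff_one]
  split_ifs <;> simp

theorem gSeq_equation (he : e ≠ 0) (hg : g ≠ 0) (hq : IsGeneric q) (h0 : p 0 = e • 1) :
    (.mk p * (dil q (.mk (gSeq q e g p)) * dil q⁻¹ (.mk (gSeq q e g p))) : PowerSeries U) =
      (e * g * g) • 1 := by
  ext n
  rcases n with - | n
  · rw [coeff_zero_mul_coeff, coeff_zero_mul_coeff]
    simp only [coeff_dil, coeff_mk, pow_zero, gSeq_zero, h0, coeff_smul_one, if_true,
      smul_mul_assoc, mul_smul_comm, smul_smul, one_mul]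
    congr 1; ring
  · set T : PowerSeries U := .mk (trunc q e g p n) with hT
    set R : PowerSeries U := .mk (gSeq q e g p) - T with hR
    have hGR : (.mk (gSeq q e g p) : PowerSeries U) = T + R := by simp [hR]
    have hR0 : ∀ m < n + 1, coeff m R = 0 := by
      intro m hm
      simp only [hR, hT, map_sub, coeff_mk, trunc_of_le (Nat.lt_succ_iff.1 hm), sub_self]
    have hR1 : coeff (n + 1) R = gSeq q e g p (n + 1) := by
      simp [hR, hT, trunc_of_lt (Nat.lt_succ_self n)]
    have hT0 : coeff 0 T = g • 1 := by
      rw [hT, coeff_mk, trunc_of_le n.zero_le, gSeq_zero]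
    have hd : ∀ c : K, ∀ m < n + 1, coeff m (dil c R) = 0 := by
      intro c m hm; rw [coeff_dil, hR0 m hm, smul_zero]
    rw [hGR, dil_add, dil_add, add_mul, mul_add, mul_add, mul_add, mul_add, mul_add, map_add,
      map_add,
      map_add, coeff_mul_of_lt_right (coeff_mul_eq_zero_of_lt_right (hd q⁻¹)),
      coeff_mul_of_lt_right (coeff_mul_eq_zero_of_lt_left (hd q)),
      coeff_mul_of_lt_right (coeff_mul_eq_zero_of_lt_left (hd q)),
      coeff_mul_of_lt_right (hd _), coeff_mul_of_lt_left (hd _), coeff_mul_of_lt_left (hd _),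
      coeff_dil q⁻¹ R 0, hR0 0 n.succ_pos, coeff_mk, h0]
    simp only [coeff_dil, hR1, hT0, smul_mul_assoc, mul_smul_comm, one_mul, mul_one, smul_smul,
      pow_zero, smul_zero, mul_zero, add_zero]
    have hc : e * g * (q ^ (n + 1) + q⁻¹ ^ (n + 1)) ≠ 0 :=
      mul_ne_zero (mul_ne_zero he hg) (hq.add_ne_zero _)
    have h := gSeq_succ (q := q) (e := e) (g := g) (p := p) n
    rw [← hT] at h
    rw [coeff_smul_one, if_neg n.succ_ne_zero, add_assoc, ← add_smul, h, smul_smul,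
      show (q⁻¹ ^ (n + 1) * g * e + g * q ^ (n + 1) * e) *
        -(e * g * (q ^ (n + 1) + q⁻¹ ^ (n + 1)))⁻¹ = -1 by
          rw [mul_neg, ← mul_inv_cancel₀ hc]; ring, neg_smul, one_smul,
      add_neg_cancel]

/-- The coefficientwise exchange relation between `ψ(t)` and `x(t)` in series form. -/
theorem series_exchange {q : K} {p x : ℕ → U} (hd : q ^ 2 - q⁻¹ ^ 2 ≠ 0)
    (h0 : ∀ z, Commute (p 0) z)
    (h : ∀ k l, p (k + 1) * x l - x l * p (k + 1) =
      q ^ 2 • (p k * x (l + 1)) - q⁻¹ ^ 2 • (x (l + 1) * p k)) :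
    (.mk p * dil (q⁻¹ ^ 2) (.mk x) : PowerSeries U) = dil (q ^ 2) (.mk x) * .mk p := by
  set c : ℕ → K := fun j => (q ^ 2 - q⁻¹ ^ 2)⁻¹ * ((q ^ 2) ^ j - (q⁻¹ ^ 2) ^ j) with hc
  have hc0 : c 0 = 0 := by simp [hc]
  have hc1 : ∀ j, c (j + 1) - q ^ 2 * c j = (q⁻¹ ^ 2) ^ j := by
    intro j; simp only [hc]; generalize q⁻¹ = v at *; field_simp; ring
  have hc2 : ∀ j, c (j + 1) - q⁻¹ ^ 2 * c j = (q ^ 2) ^ j := by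
    intro j; simp only [hc]; generalize q⁻¹ = v at *; field_simp; ring
  rw [← sub_eq_zero]
  ext n
  have e : coeff n (.mk p * dil (q⁻¹ ^ 2) (.mk x) - dil (q ^ 2) (.mk x) * .mk p) =
      ∑ i ∈ antidiagonal n, c (i.2 + 1) • (p i.1 * x i.2 - x i.2 * p i.1) -
      ∑ i ∈ antidiagonal n, c i.2 • (q ^ 2 • (p i.1 * x i.2) - q⁻¹ ^ 2 • (x i.2 * p i.1)) := by
    rw [map_sub, coeff_mul, coeff_mul, ← Finset.Nat.sum_antidiagonal_swap (f := fun i =>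
      coeff i.1 (dil (q ^ 2) (.mk x)) * coeff i.2 (.mk p)), ← sum_sub_distrib, ← sum_sub_distrib]
    refine sum_congr rfl fun i _ => ?_
    simp only [coeff_dil, coeff_mk, Prod.fst_swap, Prod.snd_swap, ← hc1, ← hc2]
    simp only [mul_smul_comm, smul_mul_assoc]
    module
  rw [e, map_zero]
  rcases n with - | n
  · simp [hc0, (h0 _).eq]
  · rw [Finset.Nat.sum_antidiagonal_succ, Finset.Nat.sum_antidiagonal_succ', (h0 _).eq]
    simp only [hc0, zero_smul, sub_self, smul_zero, zero_add, h]

/-- If `ψ(t) X(q⁻²t) = X(q²t) ψ(t)`, then the twisted square root of `ψ` satisfies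
`G(t) X(qt) = X(q⁻¹t) G(t)`. -/
theorem sqrt_exchange {q c : K} {P Q X : PowerSeries U} (hq : IsGeneric q) (hc : c ≠ 0)
    {g : K} (hg0 : coeff 0 Q = g • 1) {e : K} (he0 : coeff 0 P = e • 1)
    (hge : c = e * g * g) (hPQ : Commute P (dil q Q))
    (hQ : P * (dil q Q * dil q⁻¹ Q) = c • 1)
    (hP : P * dil (q⁻¹ ^ 2) X = dil (q ^ 2) X * P) :
    Q * dil q X = dil q⁻¹ X * Q := by
  set Z := Q * dil q X - dil q⁻¹ X * Q with hZ
  have hqq : q⁻¹ * q = 1 := inv_mul_cancel₀ hq.ne_zero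
  have hqq' : q * q⁻¹ = 1 := mul_inv_cancel₀ hq.ne_zero
  have h1 : dil q Z = dil q Q * dil (q ^ 2) X - X * dil q Q := by
    rw [hZ, dil_sub, dil_mul, dil_mul, dil_dil, dil_dil, hqq', dil_one, pow_two]
  have h2 : dil q⁻¹ Z = dil q⁻¹ Q * X - dil (q⁻¹ ^ 2) X * dil q⁻¹ Q := by
    rw [hZ, dil_sub, dil_mul, dil_mul, dil_dil, dil_dil, hqq, dil_one, pow_two]
  have key : dil q Q * P * dil q⁻¹ Z + dil q Z * (P * dil q⁻¹ Q) = 0 := by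
    have e1 : dil q Q * P * dil q⁻¹ Q = c • 1 := by rw [← hPQ.eq, mul_assoc, hQ]
    have e2 : dil q Q * P * dil (q⁻¹ ^ 2) X * dil q⁻¹ Q =
        dil q Q * dil (q ^ 2) X * (P * dil q⁻¹ Q) := by
      rw [mul_assoc (dil q Q), hP]; simp only [mul_assoc]
    have e3 : X * dil q Q * (P * dil q⁻¹ Q) = c • X := by
      rw [mul_assoc, ← mul_assoc (dil q Q), e1, mul_smul_comm, mul_one]
    rw [h1, h2, mul_sub, sub_mul, ← mul_assoc, ← mul_assoc, e1, e2, e3, smul_mul_assoc, one_mul]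
    abel
  have hz : ∀ n, coeff n Z = 0 := by
    intro n
    induction n using Nat.strong_induction_on with
    | _ n ih =>
      have hd : ∀ d : K, ∀ m < n, coeff m (dil d Z) = 0 := by
        intro d m hm; rw [coeff_dil, ih m hm, smul_zero]
      have h := congrArg (coeff n) key
      rw [map_add, map_zero, coeff_mul_of_lt_right (hd _), coeff_mul_of_lt_left (hd _),
        coeff_zero_mul_coeff, coeff_zero_mul_coeff] at h
      simp only [coeff_dil, hg0, he0, pow_zero, smul_mul_assoc, mul_smul_comm, one_mul,
        mul_one, smul_smul, ← add_smul] at h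
      refine (smul_eq_zero.1 h).resolve_left ?_
      have := hq.add_ne_zero n
      rw [hge] at hc
      have h' : e * g * (q ^ n + q⁻¹ ^ n) ≠ 0 := mul_ne_zero (left_ne_zero_of_mul hc) this
      rwa [show q⁻¹ ^ n * (e * g) + g * e * q ^ n = e * g * (q ^ n + q⁻¹ ^ n) by ring]
  rw [← sub_eq_zero, ← hZ]
  ext n; rw [hz n, map_zero]

/-- Coefficientwise form of `G(t) X(qt) = X(q⁻¹t) G(t)`. -/
theorem exchange_of_series {q : K} {g x : ℕ → U}
    (h : ∀ l, (.mk g * dil q (.mk fun j => x (l + j)) : PowerSeries U) =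
      dil q⁻¹ (.mk fun j => x (l + j)) * .mk g) (k l : ℕ) :
    g (k + 1) * x l - x l * g (k + 1) = q⁻¹ • (g k * x (l + 1)) - q • (x (l + 1) * g k) := by
  have hX : ∀ (d : K) l, (dil d (.mk fun j => x (l + j)) : PowerSeries U) =
      C (x l) + d • (dil d (.mk fun j => x (l + 1 + j)) * X) := by
    intro d l
    ext n
    rcases n with - | n
    · rw [map_add, PowerSeries.coeff_smul, coeff_zero_mul_coeff]
      simp [-coeff_zero_eq_constantCoeff, coeff_zero_X, coeff_C]
    · rw [map_add, PowerSeries.coeff_smul, coeff_succ_mul_X]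
      simp [pow_succ', smul_smul, add_assoc, add_comm 1 n]
  have comm1 : ∀ l, (.mk g * C (x l) - C (x l) * .mk g : PowerSeries U) =
      (q⁻¹ - q) • (.mk g * dil q (.mk fun j => x (l + 1 + j)) * X) := by
    intro l
    have h1 := h l
    rw [hX, hX q⁻¹, mul_add, add_mul, mul_smul_comm, smul_mul_assoc, mul_assoc _ X,
      ← (commute_X (.mk g)).eq, ← mul_assoc, ← mul_assoc, ← h (l + 1)] at h1
    rw [← sub_eq_zero] at h1 ⊢
    rw [← h1]
    module
  have main : (.mk g * C (x l) - C (x l) * .mk g : PowerSeries U) =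
      (q⁻¹ • (.mk g * C (x (l + 1))) - q • (C (x (l + 1)) * .mk g)) * X := by
    have h2 := congrArg (fun z => q • (z * X)) (comm1 (l + 1))
    rw [comm1 l, hX]
    have h3 : q • ((PowerSeries.mk g * C (x (l + 1)) - C (x (l + 1)) * PowerSeries.mk g) * X) =
      q • (((q⁻¹ - q) • (.mk g * dil q (.mk fun j => x (l + 1 + 1 + j)) * X)) * X) := h2
    simp only [sub_mul, smul_sub, smul_mul_assoc, mul_add, add_mul, mul_smul_comm, smul_add,
      smul_smul, ← mul_assoc] at h3 ⊢
    rw [← sub_eq_zero] at h3 ⊢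
    rw [← neg_eq_zero, ← h3]
    module
  have hk := congrArg (coeff (k + 1)) main
  rw [coeff_succ_mul_X] at hk
  simpa [PowerSeries.coeff_smul] using hk

end Sqrt

/-- The `q`-commutator over an arbitrary field. -/
def qb {K U : Type*} [Field K] [Ring U] [Algebra K U] (q : K) (x y : U) : U :=
  q • (x * y) - q⁻¹ • (y * x)

/-- Root vectors `x`, `y` with imaginary root vectors `ψ` and alternating elements `G`,
together with an antiautomorphism `S` exchanging `x` and `y`. -/
structure RootSystem {K : Type*} [Field K] (q ρ : K) (U : Type*) [Ring U] [Algebra K U] where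
  generic : IsGeneric q
  ρ_ne_zero : ρ ≠ 0
  x : ℕ → U
  y : ℕ → U
  G : ℕ → U
  ψ : ℕ → U
  S : U →ₗ[K] U
  S_mul : ∀ z w, S (z * w) = S w * S z
  S_x : ∀ n, S (x n) = y n
  S_y : ∀ n, S (y n) = x n
  S_G : ∀ n, S (G n) = G n
  yx : ∀ i j, qb q (y i) (x j) = ψ (i + j + 1)
  xx : ∀ i j, x (i + 1) * x j + x (j + 1) * x i - q ^ 2 • (x j * x (i + 1) + x i * x (j + 1)) = 0
  G_comm : ∀ i j, Commute (G i) (G j)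
  ψ_comm : ∀ i j, Commute (ψ i) (G j)
  G_zero : G 0 = (ρ / (q - q⁻¹)) • 1
  G_one : G 1 = ψ 1
  ψ_zero : ψ 0 = (-ρ / (q ^ 2 - q⁻¹ ^ 2)) • 1
  G_x : ∀ k l, G (k + 1) * x l - x l * G (k + 1) =
    q⁻¹ • (G k * x (l + 1)) - q • (x (l + 1) * G k)
  G_x_series : (.mk G * dil q (.mk x) : PowerSeries U) = dil q⁻¹ (.mk x) * .mk G
  ψ_series : (.mk ψ * (dil q (.mk G) * dil q⁻¹ (.mk G)) : PowerSeries U) =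
    (-ρ / (q ^ 2 - q⁻¹ ^ 2) * (ρ / (q - q⁻¹)) * (ρ / (q - q⁻¹))) • 1

section
variable {K U : Type*} [Field K] [Ring U] [Algebra K U]
variable {q ρ : K}

theorem lie_qb_right (x y z : U) (h : ⁅y, z⁆ = 0) : ⁅qb q x y, z⁆ = qb q ⁅x, z⁆ y := by
  have e : q • (x * ⁅y, z⁆) - q⁻¹ • (⁅y, z⁆ * x) = 0 := by simp [h]
  rw [← sub_eq_zero, ← e]
  simp only [qb, Ring.lie_def, mul_sub, sub_mul, smul_mul_assoc, mul_smul_comm, smul_sub, mul_assoc]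
  module

theorem lie_qb_left (x y z : U) (h : ⁅x, z⁆ = 0) : ⁅qb q x y, z⁆ = qb q x ⁅y, z⁆ := by
  have e : q • (⁅x, z⁆ * y) - q⁻¹ • (y * ⁅x, z⁆) = 0 := by simp [h]
  rw [← sub_eq_zero, ← e]
  simp only [qb, Ring.lie_def, mul_sub, sub_mul, smul_mul_assoc, mul_smul_comm, smul_sub, mul_assoc]
  module

theorem qb_qb_comm (x g h : U) (hgh : Commute g h) : qb q (qb q x g) h = qb q (qb q x h) g := by
  have e : q ^ 2 • (x * (g * h - h * g)) + q⁻¹ ^ 2 • ((h * g - g * h) * x) = 0 := by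
    simp [hgh.eq]
  rw [← sub_eq_zero, ← e]
  simp only [qb, mul_sub, sub_mul, smul_mul_assoc, mul_smul_comm, smul_sub, mul_assoc, smul_smul]
  match_scalars <;> ring

theorem lie_swap (x y : U) : ⁅x, y⁆ = -⁅y, x⁆ := by simp [Ring.lie_def]

theorem lie_smul_left (c : K) (x y : U) : ⁅c • x, y⁆ = c • ⁅x, y⁆ := by
  simp [Ring.lie_def, smul_sub]

theorem lie_smul_right (c : K) (x y : U) : ⁅x, c • y⁆ = c • ⁅x, y⁆ := by
  simp [Ring.lie_def, smul_sub]

theorem lie_symm_zero {x y : U} (h : ⁅x, y⁆ = 0) : ⁅y, x⁆ = 0 := by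
  rw [Ring.lie_def, sub_eq_zero] at h ⊢; exact h.symm

/-- The antisymmetrization of `[[x, g]_q, [h, y]_q]` in `g` and `h`. -/
theorem lie_qb_qb_sub (hq : q ≠ 0) (x y g h : U) (hgh : Commute g h) (hg : Commute (qb q y x) g)
    (hh : Commute (qb q y x) h) :
    ⁅qb q x g, qb q h y⁆ - ⁅qb q x h, qb q g y⁆ = ⁅⁅x, g⁆, ⁅h, y⁆⁆ - ⁅⁅x, h⁆, ⁅g, y⁆⁆ := by
  have e0 : h * qb q y x * g - g * qb q y x * h = 0 := by
    rw [mul_assoc, hg.eq, mul_assoc, hh.eq, ← mul_assoc, ← mul_assoc, hgh.eq, sub_self]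
  have e : -(q - q⁻¹) • (h * qb q y x * g - g * qb q y x * h) +
      (q ^ 2 - 1) • (x * (g * h - h * g) * y) - (q⁻¹ ^ 2 - 1) • (y * (h * g - g * h) * x) = 0 := by
    rw [e0, hgh.eq]; simp
  rw [← sub_eq_zero, ← e]
  simp only [qb, Ring.lie_def, mul_sub, sub_mul, smul_mul_assoc, mul_smul_comm, smul_sub, mul_assoc,
    smul_smul]
  match_scalars <;> field_simp <;> ring

namespace RootSystem
variable (R : RootSystem q ρ U)

include R in
theorem kappa_ne_zero : q - q⁻¹ ≠ 0 := by
  simpa using R.generic.sub_ne_zero one_pos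

theorem S_qb (z w : U) : R.S (qb q z w) = qb q (R.S w) (R.S z) := by
  simp [qb, R.S_mul]

theorem S_lie (z w : U) : R.S ⁅z, w⁆ = ⁅R.S w, R.S z⁆ := by
  simp [Ring.lie_def, R.S_mul]

/-- The unnormalized alternating elements `[x_m, G_k]_q`. -/
def u (m k : ℕ) : U := qb q (R.x m) (R.G k)

/-- The unnormalized alternating elements `[G_k, y_m]_q`. -/
def v (m k : ℕ) : U := qb q (R.G k) (R.y m)

theorem S_u (m k : ℕ) : R.S (R.u m k) = R.v m k := by
  rw [u, S_qb, S_x, S_G, v]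

theorem lie_x_G (m k : ℕ) : ⁅R.x m, R.G (k + 1)⁆ = R.u (m + 1) k := by
  rw [Ring.lie_def, ← neg_sub, R.G_x, u, qb, neg_sub]

theorem lie_G_y (m k : ℕ) : ⁅R.G (k + 1), R.y m⁆ = R.v (m + 1) k := by
  have h := congrArg R.S (R.lie_x_G m k)
  rwa [S_lie, S_x, S_G, S_u] at h

theorem lie_G_G (k l : ℕ) : ⁅R.G k, R.G l⁆ = 0 := by
  rw [Ring.lie_def, (R.G_comm k l).eq, sub_self]

theorem lie_u_G (m k l : ℕ) : ⁅R.u m k, R.G (l + 1)⁆ = ⁅R.u m l, R.G (k + 1)⁆ := by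
  rw [u, u, lie_qb_right _ _ _ (R.lie_G_G _ _), lie_qb_right _ _ _ (R.lie_G_G _ _), lie_x_G,
    lie_x_G, u, u, qb_qb_comm _ _ _ (R.G_comm _ _)]

theorem lie_G_v (m k l : ℕ) : ⁅R.G (l + 1), R.v m k⁆ = ⁅R.G (k + 1), R.v m l⁆ := by
  have h := congrArg R.S (R.lie_u_G m k l)
  rwa [S_lie, S_lie, S_u, S_u, S_G, S_G] at h

theorem lie_u_y (k : ℕ) : ⁅R.u 0 k, R.y 0⁆ = ⁅R.x 0, R.v 0 k⁆ := by
  have h := (R.ψ_comm 1 k).eq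
  have e : R.ψ 1 * R.G k - R.G k * R.ψ 1 = 0 := sub_eq_zero.2 h
  rw [← R.yx 0 0] at e
  rw [eq_comm, ← sub_eq_zero, ← e]
  simp only [u, v, qb, Ring.lie_def, mul_sub, sub_mul, smul_mul_assoc, mul_smul_comm,
    mul_assoc]
  module

theorem lie_u_v (m n k l : ℕ) : ⁅R.u m k, R.v n l⁆ = ⁅R.u m l, R.v n k⁆ := by
  have hψ : ∀ m n k, Commute (qb q (R.y n) (R.x m)) (R.G k) := fun m n k => by
    rw [yx]; exact R.ψ_comm _ _
  have hz : ∀ z : U, ⁅z, R.G 0⁆ = 0 ∧ ⁅R.G 0, z⁆ = 0 := fun z => by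
    simp [G_zero, Ring.lie_def]
  induction k generalizing m n l with
  | zero =>
    rw [← sub_eq_zero, u, u, v, v, lie_qb_qb_sub R.generic.ne_zero _ _ _ _ (R.G_comm _ _)
      (hψ _ _ _) (hψ _ _ _), (hz _).1, (hz _).2]
    simp [Ring.lie_def]
  | succ k ih =>
    rw [← sub_eq_zero, u, u, v, v, lie_qb_qb_sub R.generic.ne_zero _ _ _ _ (R.G_comm _ _)
      (hψ _ _ _) (hψ _ _ _)]
    rcases l with - | l
    · rw [(hz _).1, (hz _).2]; simp [Ring.lie_def]
    · rw [lie_x_G, lie_G_y, lie_x_G, lie_G_y, ih, sub_self]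

theorem u_zero (m : ℕ) : R.u m 0 = ρ • R.x m := by
  rw [u, qb, G_zero]
  simp only [mul_smul_comm, smul_mul_assoc, one_mul, mul_one, smul_smul, ← sub_smul]
  congr 1
  have := R.kappa_ne_zero
  rw [← sub_mul]
  generalize q - q⁻¹ = κ at *
  field_simp

theorem v_zero (m : ℕ) : R.v m 0 = ρ • R.y m := by
  rw [← S_u, u_zero, map_smul, S_x]

theorem u_succ (m k : ℕ) :
    R.u m (k + 1) = (q - q⁻¹) • (R.x m * R.G (k + 1)) + q⁻¹ • R.u (m + 1) k := by
  rw [← lie_x_G, u, qb, Ring.lie_def]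
  module

theorem u_eq_sum (m k : ℕ) : R.u m k =
    (q - q⁻¹) • ∑ i ∈ antidiagonal k, q⁻¹ ^ i.1 • (R.x (m + i.1) * R.G i.2) := by
  induction k generalizing m with
  | zero =>
    rw [Finset.Nat.antidiagonal_zero, sum_singleton, u_zero, G_zero]
    simp only [mul_smul_comm, mul_one, smul_smul, pow_zero, add_zero]
    congr 1
    have := R.kappa_ne_zero
    generalize q - q⁻¹ = κ at *
    field_simp
  | succ k ih =>
    rw [u_succ, ih, Finset.Nat.sum_antidiagonal_succ, smul_add, smul_comm q⁻¹, smul_sum]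
    simp [pow_succ', smul_smul, add_assoc, add_comm 1]

theorem x_zero_mul_x (n : ℕ) : R.x 0 * R.x n - q ^ 2 • (R.x n * R.x 0) =
    (1 - q ^ 2) • ∑ i ∈ antidiagonal n, R.x i.1 * R.x i.2 := by
  rcases n with - | n
  · simp [sub_smul]
  have hA := Finset.Nat.sum_antidiagonal_succ (n := n) (f := fun i => R.x i.1 * R.x i.2)
  have hB := Finset.Nat.sum_antidiagonal_succ' (n := n) (f := fun i => R.x i.1 * R.x i.2)
  have hs : ∑ i ∈ antidiagonal n, (R.x (i.1 + 1) * R.x i.2 + R.x (i.2 + 1) * R.x i.1 -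
      q ^ 2 • (R.x i.2 * R.x (i.1 + 1) + R.x i.1 * R.x (i.2 + 1))) = 0 :=
    sum_eq_zero fun i _ => R.xx i.1 i.2
  have h1 := Finset.Nat.sum_antidiagonal_swap (n := n) (f := fun i => R.x (i.1 + 1) * R.x i.2)
  have h2 := Finset.Nat.sum_antidiagonal_swap (n := n) (f := fun i => R.x i.1 * R.x (i.2 + 1))
  simp only [Prod.fst_swap, Prod.snd_swap] at hA hB h1 h2
  rw [sum_sub_distrib, sum_add_distrib, h1, ← smul_sum, sum_add_distrib, h2, ← two_smul K,
    ← two_smul K, smul_comm, ← smul_sub] at hs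
  have hs := (smul_eq_zero.1 hs).resolve_left R.generic.two_ne_zero
  rw [hA] at hB ⊢
  generalize ∑ i ∈ antidiagonal n, R.x (i.1 + 1) * R.x i.2 = A at *
  generalize ∑ i ∈ antidiagonal n, R.x i.1 * R.x (i.2 + 1) = B at *
  rw [← sub_eq_zero] at hB ⊢
  have e : -(A - q ^ 2 • B) + q ^ 2 • (R.x 0 * R.x (n + 1) + A -
      (B + R.x (n + 1) * R.x 0)) = 0 := by
    rw [hs, add_comm B, hB]; simp
  rw [← e]
  module

/-- The generating series of the `x_n`. -/
def X : PowerSeries U := .mk R.x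

/-- The generating series of the `y_n`. -/
def Y : PowerSeries U := .mk R.y

/-- The generating series of the `G_n`. -/
def Gs : PowerSeries U := .mk R.G

/-- The generating series of the `ψ_n`. -/
def Ψ : PowerSeries U := .mk R.ψ

theorem mk_u : (.mk (R.u 0) : PowerSeries U) = (q - q⁻¹) • (dil q⁻¹ R.X * R.Gs) := by
  ext n
  rw [PowerSeries.coeff_smul, coeff_mk, coeff_mul, u_eq_sum]
  simp [X, Gs]

theorem Gs_mul_C : R.Gs * C (R.x 0) = q ^ 2 • (C (R.x 0) * R.Gs) -
    (q * (q - q⁻¹)) • (dil q⁻¹ R.X * R.Gs) := by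
  rw [← smul_smul, ← mk_u]
  ext n
  have := R.generic.ne_zero
  simp only [map_sub, PowerSeries.coeff_smul, coeff_mul_C, coeff_C_mul, coeff_mk, Gs, u, qb]
  match_scalars <;> field_simp
  ring

theorem C_mul_X (c : K) : C (R.x 0) * dil c R.X =
    q ^ 2 • (dil c R.X * C (R.x 0)) + (1 - q ^ 2) • (dil c R.X * dil c R.X) := by
  ext n
  rw [← dil_mul]
  have h := congrArg (fun z => c ^ n • z) (R.x_zero_mul_x n)
  simp only [smul_sub] at h
  simp only [map_add, PowerSeries.coeff_smul, coeff_mul_C, coeff_C_mul, coeff_dil,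
    X, coeff_mk, mul_smul_comm, smul_mul_assoc]
  simp only [coeff_mul, coeff_mk]
  rw [smul_comm _ (c ^ n), smul_comm _ (c ^ n), ← h]
  abel

theorem lie_x_u (k : ℕ) : ⁅R.x 0, R.u 0 k⁆ = 0 := by
  have h : C (R.x 0) * PowerSeries.mk (R.u 0) - PowerSeries.mk (R.u 0) * C (R.x 0) = 0 := by
    have hq := R.generic.ne_zero
    rw [mk_u, mul_smul_comm, smul_mul_assoc, ← mul_assoc, C_mul_X, mul_assoc, Gs_mul_C]
    simp only [mul_sub, add_mul, mul_smul_comm, smul_mul_assoc, mul_assoc, smul_sub, smul_add,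
      smul_smul]
    match_scalars <;> field_simp <;> ring
  simpa [Ring.lie_def] using congrArg (coeff k) h

theorem lie_u_u (k l : ℕ) : ⁅R.u 0 k, R.u 0 l⁆ = 0 := by
  induction k generalizing l with
  | zero => rw [u_zero, lie_smul_left, lie_x_u, smul_zero]
  | succ k ih =>
    have h : ∀ k l, ⁅R.u 0 (k + 1), R.u 0 l⁆ = qb q (R.x 0) ⁅R.G (k + 1), R.u 0 l⁆ := fun k l => by
      conv_lhs => rw [u]
      exact lie_qb_left _ _ _ (R.lie_x_u l)
    rw [h, lie_swap, lie_u_G, ← lie_swap, ← h, lie_swap, ih, neg_zero]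

theorem lie_v_v (k l : ℕ) : ⁅R.v 0 k, R.v 0 l⁆ = 0 := by
  have h := congrArg R.S (R.lie_u_u l k)
  rwa [S_lie, S_u, S_u, map_zero] at h

end RootSystem
end

section
variable {K U : Type*} [Field K] [Ring U] [Algebra K U]
variable {q ρ : K}

/-- The coefficientwise application of a linear map to a power series. -/
def smap (S : U →ₗ[K] U) (f : PowerSeries U) : PowerSeries U := .mk fun n => S (coeff n f)

theorem smap_mul {S : U →ₗ[K] U} (hS : ∀ z w, S (z * w) = S w * S z) (f g : PowerSeries U) :
    smap S (f * g) = smap S g * smap S f := by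
  ext n
  rw [coeff_mul, ← Finset.Nat.sum_antidiagonal_swap]
  simp [smap, coeff_mul, hS]

theorem smap_dil (S : U →ₗ[K] U) (c : K) (f : PowerSeries U) :
    smap S (dil c f) = dil c (smap S f) := by
  ext n; simp [smap]

theorem smap_mk (S : U →ₗ[K] U) (p : ℕ → U) : smap S (.mk p) = .mk fun n => S (p n) := by
  ext n; simp [smap]

theorem smap_C {S : U →ₗ[K] U} (z : U) : smap S (C z) = C (S z) := by
  ext n; simp only [smap, coeff_mk, coeff_C]; split_ifs <;> simp

theorem smap_smul {S : U →ₗ[K] U} (c : K) (f : PowerSeries U) : smap S (c • f) = c • smap S f := by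
  ext n; simp [smap]

theorem smap_sub {S : U →ₗ[K] U} (f g : PowerSeries U) :
    smap S (f - g) = smap S f - smap S g := by
  ext n; simp [smap]

theorem dil_C (c : K) (z : U) : dil c (C z) = C z := by
  ext n; rw [coeff_dil, coeff_C]; split_ifs with h <;> simp [h]

theorem dil_X (c : K) : dil c (PowerSeries.X : PowerSeries U) = c • PowerSeries.X := by
  ext n; rw [coeff_dil, PowerSeries.coeff_smul, coeff_X]; split_ifs with h <;> simp [h]

/-- The element `Y_{n+1}` attached to a family of alternating elements. -/
def yEl (q ρ : K) (wm wp g gt : ℕ → U) (n : ℕ) : U :=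
  q ^ (-(n : ℤ) - 1) • g n + q ^ ((n : ℤ) + 1) • gt n -
    (q ^ (2 : ℤ) - q ^ (-2 : ℤ)) •
      ∑ k ∈ Finset.range (n + 1), q ^ (2 * (k : ℤ) - (n : ℤ)) • (wm k * wp (n - k)) +
    ((q - q⁻¹) / ρ) •
      ∑ k ∈ Finset.range n, q ^ (2 * (k : ℤ) - (n : ℤ) + 1) • (gt k * g (n - 1 - k))

/-- The elements `Y_{n+1}` are the coefficients of a product of generating series. -/
theorem coeff_eq_yEl (hq : q ≠ 0) (hρ : ρ ≠ 0) (hκ : q - q⁻¹ ≠ 0) (wm wp A B : ℕ → U)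
    (hA : A 0 = (ρ / (q - q⁻¹)) • 1) (hB : B 0 = (ρ / (q - q⁻¹)) • 1) (n : ℕ) :
    coeff (n + 1) (((q - q⁻¹) / ρ) • (dil q (.mk A) * dil q⁻¹ (.mk B)) -
      (q ^ 2 - q⁻¹ ^ 2) • (dil q (.mk wm) * dil q⁻¹ (.mk wp) * PowerSeries.X)) =
    yEl q ρ wm wp (fun k => B (k + 1)) (fun k => A (k + 1)) n := by
  have hpow : ∀ i j : ℕ, q⁻¹ ^ j * q ^ i = q ^ ((i : ℤ) - j) := by
    intro i j; rw [zpow_sub₀ hq, zpow_natCast, zpow_natCast, inv_pow, div_eq_mul_inv, mul_comm]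
  have hsum : ∀ c d : ℕ → U, ∀ n, coeff n (dil q (.mk c) * dil q⁻¹ (.mk d)) =
      ∑ k ∈ range (n + 1), q ^ (2 * (k : ℤ) - n) • (c k * d (n - k)) := by
    intro c d n
    rw [coeff_mul, Finset.Nat.sum_antidiagonal_eq_sum_range_succ (fun i j =>
      coeff i (dil q (.mk c)) * coeff j (dil q⁻¹ (.mk d)))]
    refine sum_congr rfl fun k hk => ?_
    have hk := Finset.mem_range_succ_iff.1 hk
    simp only [coeff_dil, coeff_mk, smul_mul_assoc, mul_smul_comm, smul_smul, hpow]
    congr 2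
    omega
  rw [map_sub, PowerSeries.coeff_smul, PowerSeries.coeff_smul, coeff_succ_mul_X, hsum, hsum, yEl,
    sum_range_succ', sum_range_succ]
  have h2 : q ^ (2 : ℤ) - q ^ (-2 : ℤ) = q ^ 2 - q⁻¹ ^ 2 := by
    rw [zpow_neg, inv_pow]; norm_cast
  have hc : (q - q⁻¹) / ρ * (ρ / (q - q⁻¹)) = 1 := by
    generalize q - q⁻¹ = κ at *
    field_simp
  have hl : ∑ k ∈ range n, q ^ (2 * ((k + 1 : ℕ) : ℤ) - ((n + 1 : ℕ) : ℤ)) •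
      (A (k + 1) * B (n + 1 - (k + 1))) =
      ∑ k ∈ range n, q ^ (2 * (k : ℤ) - (n : ℤ) + 1) • (A (k + 1) * B (n - 1 - k + 1)) := by
    refine sum_congr rfl fun k hk => ?_
    have hk := Finset.mem_range.1 hk
    congr 2
    · push_cast; ring
    · congr 1; omega
  rw [hl, h2]
  simp only [hA, hB, Nat.sub_self, Nat.sub_zero, smul_add, smul_mul_assoc, mul_smul_comm, one_mul,
    mul_one]
  have e1 : (2 * ((n + 1 : ℕ) : ℤ) - ((n + 1 : ℕ) : ℤ)) = n + 1 := by push_cast; ring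
  have e2 : (2 * ((0 : ℕ) : ℤ) - ((n + 1 : ℕ) : ℤ)) = -n - 1 := by push_cast; ring
  rw [e1, e2]
  generalize (q - q⁻¹) / ρ = d at *
  generalize ρ / (q - q⁻¹) = d' at *
  generalize q ^ ((n : ℤ) + 1) = c1
  generalize q ^ (-(n : ℤ) - 1) = c2
  have e : (d * d' - 1) • (c1 • A (n + 1) + c2 • B (n + 1)) = 0 := by rw [hc, sub_self, zero_smul]
  rw [← sub_eq_zero, ← e]
  match_scalars <;> ring

/-- The relations which determine a family of alternating elements from its first members. -/
structure IsAlternating (q ρ : K) (wm wp g gt : ℕ → U) : Prop where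
  lie_zero : ∀ k, ⁅wm 0, wp k⁆ = (q + q⁻¹)⁻¹ • (gt k - g k)
  lie_zero' : ∀ k, ⁅wm k, wp 0⁆ = (q + q⁻¹)⁻¹ • (gt k - g k)
  wm_g : ∀ k, qb q (wm 0) (g k) = ρ • wm (k + 1)
  gt_wm : ∀ k, qb q (gt k) (wm 0) = ρ • wm (k + 1)
  g_wp : ∀ k, qb q (g k) (wp 0) = ρ • wp (k + 1)
  wp_gt : ∀ k, qb q (wp 0) (gt k) = ρ • wp (k + 1)
  yEl_add : ∀ n, yEl q ρ wm wp g gt n + yEl q ρ wp wm gt g n = 0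

theorem IsAlternating.swap {wm wp g gt : ℕ → U} (h : IsAlternating q ρ wm wp g gt) :
    IsAlternating q ρ wp wm gt g where
  lie_zero k := by rw [lie_swap, h.lie_zero', ← smul_neg, neg_sub]
  lie_zero' k := by rw [lie_swap, h.lie_zero, ← smul_neg, neg_sub]
  wm_g := h.wp_gt
  gt_wm := h.g_wp
  g_wp := h.gt_wm
  wp_gt := h.wm_g
  yEl_add n := by rw [add_comm, h.yEl_add]

theorem IsAlternating.ext (hq : IsGeneric q) (hρ : ρ ≠ 0) {wm wp g gt wm' wp' g' gt' : ℕ → U}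
    (h : IsAlternating q ρ wm wp g gt) (h' : IsAlternating q ρ wm' wp' g' gt')
    (h0 : wm 0 = wm' 0) (h1 : wp 0 = wp' 0) (n : ℕ) :
    wm n = wm' n ∧ wp n = wp' n ∧ g n = g' n ∧ gt n = gt' n := by
  have hs : q + q⁻¹ ≠ 0 := by simpa using hq.add_ne_zero 1
  have hG : ∀ n, (∀ k < n, g k = g' k ∧ gt k = gt' k) → (∀ k ≤ n, wm k = wm' k ∧ wp k = wp' k) →
      g n = g' n ∧ gt n = gt' n := by
    intro n hg hw
    have e1 : gt n - g n = gt' n - g' n := by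
      have := h.lie_zero' n
      rw [(hw n le_rfl).1, h1, h'.lie_zero'] at this
      exact (smul_right_injective U (inv_ne_zero hs) this).symm
    have e2 : (q ^ (n + 1) + q⁻¹ ^ (n + 1)) • (g n + gt n) =
        (q ^ (n + 1) + q⁻¹ ^ (n + 1)) • (g' n + gt' n) := by
      have a1 := (h.yEl_add n).trans (h'.yEl_add n).symm
      have s1 : ∀ c : ℕ → K, ∑ k ∈ range (n + 1), c k • (wm k * wp (n - k)) =
          ∑ k ∈ range (n + 1), c k • (wm' k * wp' (n - k)) := fun c =>
        sum_congr rfl fun k hk => by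
          have := Finset.mem_range_succ_iff.1 hk
          rw [(hw k this).1, (hw (n - k) (by omega)).2]
      have s2 : ∀ c : ℕ → K, ∑ k ∈ range (n + 1), c k • (wp k * wm (n - k)) =
          ∑ k ∈ range (n + 1), c k • (wp' k * wm' (n - k)) := fun c =>
        sum_congr rfl fun k hk => by
          have := Finset.mem_range_succ_iff.1 hk
          rw [(hw k this).2, (hw (n - k) (by omega)).1]
      have s3 : ∀ c : ℕ → K, ∑ k ∈ range n, c k • (gt k * g (n - 1 - k)) =
          ∑ k ∈ range n, c k • (gt' k * g' (n - 1 - k)) := fun c =>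
        sum_congr rfl fun k hk => by
          have := Finset.mem_range.1 hk
          rw [(hg k this).2, (hg (n - 1 - k) (by omega)).1]
      have s4 : ∀ c : ℕ → K, ∑ k ∈ range n, c k • (g k * gt (n - 1 - k)) =
          ∑ k ∈ range n, c k • (g' k * gt' (n - 1 - k)) := fun c =>
        sum_congr rfl fun k hk => by
          have := Finset.mem_range.1 hk
          rw [(hg k this).1, (hg (n - 1 - k) (by omega)).2]
      have z1 : q ^ (-(n : ℤ) - 1) = q⁻¹ ^ (n + 1) := by
        rw [inv_pow, ← zpow_natCast, ← zpow_neg]; congr 1; push_cast; ring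
      have z2 : q ^ ((n : ℤ) + 1) = q ^ (n + 1) := by
        rw [← zpow_natCast]; congr 1
      simp only [yEl, s1, s2, s3, s4, z1, z2] at a1
      rw [← sub_eq_zero] at a1 ⊢
      rw [← a1]
      module
    have e3 := smul_right_injective U (hq.add_ne_zero (n + 1)) e2
    constructor
    · refine smul_right_injective U hq.two_ne_zero ?_
      simp only [two_smul]
      calc g n + g n = (g n + gt n) - (gt n - g n) := by abel
        _ = _ := by rw [e3, e1]; abel
    · refine smul_right_injective U hq.two_ne_zero ?_
      simp only [two_smul]
      calc gt n + gt n = (g n + gt n) + (gt n - g n) := by abel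
        _ = _ := by rw [e3, e1]; abel
  have key : ∀ n, (∀ k < n, g k = g' k ∧ gt k = gt' k) ∧
      (∀ k ≤ n, wm k = wm' k ∧ wp k = wp' k) := by
    intro n
    induction n with
    | zero => exact ⟨fun k hk => absurd hk (by omega), fun k hk => by
        rw [Nat.le_zero.1 hk]; exact ⟨h0, h1⟩⟩
    | succ n ih =>
      have hn := hG n ih.1 ih.2
      refine ⟨fun k hk => ?_, fun k hk => ?_⟩
      · rcases Nat.lt_succ_iff_lt_or_eq.1 hk with hk | rfl
        · exact ih.1 k hk
        · exact hn
      · rcases Nat.le_succ_iff.1 hk with hk | rfl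
        · exact ih.2 k hk
        · constructor
          · apply smul_right_injective U hρ
            simp only
            rw [← h.wm_g, ← h'.wm_g, h0, hn.1]
          · apply smul_right_injective U hρ
            simp only
            rw [← h.g_wp, ← h'.g_wp, h1, hn.1]
  exact ⟨((key n).2 n le_rfl).1, ((key n).2 n le_rfl).2, hG n (key n).1 (key n).2⟩

end

section
variable {K U V : Type*} [Field K] [Ring U] [Algebra K U] [Ring V] [Algebra K V] {q ρ : K}

theorem map_qb (τ : U →ₐ[K] V) (z w : U) : τ (qb q z w) = qb q (τ z) (τ w) := by
  simp only [qb, map_sub, map_smul, map_mul]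

theorem map_yEl (τ : U →ₐ[K] V) (wm wp g gt : ℕ → U) (n : ℕ) : τ (yEl q ρ wm wp g gt n) =
    yEl q ρ (fun k => τ (wm k)) (fun k => τ (wp k)) (fun k => τ (g k)) (fun k => τ (gt k)) n := by
  simp only [yEl, map_sub, map_add, map_smul, map_mul, map_sum]

theorem IsAlternating.map {wm wp g gt : ℕ → U} (h : IsAlternating q ρ wm wp g gt)
    (τ : U →ₐ[K] V) : IsAlternating q ρ (fun k => τ (wm k)) (fun k => τ (wp k))
      (fun k => τ (g k)) (fun k => τ (gt k)) where
  lie_zero k := by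
    simpa only [Ring.lie_def, map_sub, map_smul, map_mul] using congrArg τ (h.lie_zero k)
  lie_zero' k := by
    simpa only [Ring.lie_def, map_sub, map_smul, map_mul] using congrArg τ (h.lie_zero' k)
  wm_g k := by rw [← map_qb, h.wm_g, map_smul]
  gt_wm k := by rw [← map_qb, h.gt_wm, map_smul]
  g_wp k := by rw [← map_qb, h.g_wp, map_smul]
  wp_gt k := by rw [← map_qb, h.wp_gt, map_smul]
  yEl_add n := by rw [← map_yEl, ← map_yEl, ← map_add, h.yEl_add, map_zero]

end

namespace RootSystem
variable {K U : Type*} [Field K] [Ring U] [Algebra K U]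
variable {q ρ : K} (R : RootSystem q ρ U)

/-- The alternating elements `W_{-k}`. -/
def wm (k : ℕ) : U := ρ⁻¹ • R.u 0 k

/-- The alternating elements `W_{k+1}`. -/
def wp (k : ℕ) : U := ρ⁻¹ • R.v 0 k

/-- The alternating elements `G̃_k`, with `G̃_0 = G_0`. -/
def gt : ℕ → U
  | 0 => R.G 0
  | k + 1 => R.G (k + 1) + (q + q⁻¹) • ⁅R.wm k, R.y 0⁆

theorem S_wm (k : ℕ) : R.S (R.wm k) = R.wp k := by rw [wm, map_smul, S_u, wp]

theorem wm_zero : R.wm 0 = R.x 0 := by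
  rw [wm, u_zero, smul_smul, inv_mul_cancel₀ R.ρ_ne_zero, one_smul]

theorem wp_zero : R.wp 0 = R.y 0 := by
  rw [wp, v_zero, smul_smul, inv_mul_cancel₀ R.ρ_ne_zero, one_smul]

theorem lie_wm_y (k : ℕ) : ⁅R.wm k, R.y 0⁆ = ⁅R.x 0, R.wp k⁆ := by
  rw [wm, wp, lie_smul_left, lie_smul_right, lie_u_y]

theorem S_gt (k : ℕ) : R.S (R.gt k) = R.gt k := by
  rcases k with - | k
  · exact R.S_G 0
  · rw [gt, map_add, map_smul, S_lie, S_G, S_y, S_wm, lie_wm_y]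

include R in
theorem add_inv_ne_zero : q + q⁻¹ ≠ 0 := by
  simpa using R.generic.add_ne_zero 1

theorem lie_wm_wp_zero (k : ℕ) :
    ⁅R.wm k, R.wp 0⁆ = (q + q⁻¹)⁻¹ • (R.gt (k + 1) - R.G (k + 1)) := by
  rw [gt, add_sub_cancel_left, smul_smul, inv_mul_cancel₀ R.add_inv_ne_zero, one_smul, wp_zero]

theorem lie_wm_zero_wp (k : ℕ) :
    ⁅R.wm 0, R.wp k⁆ = (q + q⁻¹)⁻¹ • (R.gt (k + 1) - R.G (k + 1)) := by
  rw [← lie_wm_wp_zero, wm_zero, wp_zero, lie_wm_y]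

theorem qb_wm_G (k : ℕ) : qb q (R.wm 0) (R.G (k + 1)) = ρ • R.wm (k + 1) := by
  rw [wm_zero, wm, smul_smul, mul_inv_cancel₀ R.ρ_ne_zero, one_smul, u]

theorem qb_G_wp (k : ℕ) : qb q (R.G (k + 1)) (R.wp 0) = ρ • R.wp (k + 1) := by
  rw [← S_wm, ← S_G, ← S_qb, qb_wm_G, map_smul, S_wm]

theorem qb_lie_x (k : ℕ) : qb q ⁅R.wm k, R.y 0⁆ (R.x 0) = ⁅R.x 0, R.G (k + 1)⁆ := by
  have h1 : ⁅R.u 0 k, R.x 0⁆ = 0 := lie_symm_zero (R.lie_x_u k)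
  have h2 : qb q ⁅R.u 0 k, R.y 0⁆ (R.x 0) = ⁅R.u 0 k, qb q (R.y 0) (R.x 0)⁆ := by
    have e : q • (R.y 0 * ⁅R.u 0 k, R.x 0⁆) - q⁻¹ • (⁅R.u 0 k, R.x 0⁆ * R.y 0) = 0 := by
      simp [h1]
    rw [eq_comm, ← sub_eq_zero, ← e]
    simp only [qb, Ring.lie_def, mul_sub, sub_mul, smul_mul_assoc, mul_smul_comm, smul_sub,
      mul_assoc]
    module
  have h3 : qb q ⁅R.u 0 k, R.y 0⁆ (R.x 0) = ρ • ⁅R.x 0, R.G (k + 1)⁆ := by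
    rw [h2, yx, ← R.G_one]
    conv_lhs => rw [u]
    rw [lie_qb_right _ _ _ (R.lie_G_G _ _), lie_x_G, u_zero, lie_x_G, u]
    simp only [qb, smul_mul_assoc, mul_smul_comm, smul_sub]
    module
  have h4 := congrArg (ρ⁻¹ • ·) h3
  simp only [smul_smul, inv_mul_cancel₀ R.ρ_ne_zero, one_smul] at h4
  rw [← h4, wm, lie_smul_left]
  simp only [qb, smul_mul_assoc, mul_smul_comm, smul_sub]
  module

theorem qb_gt_wm (k : ℕ) : qb q (R.gt (k + 1)) (R.wm 0) = ρ • R.wm (k + 1) := by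
  rw [← qb_wm_G, wm_zero, gt]
  have e := congrArg ((q + q⁻¹) • ·) (R.qb_lie_x k)
  rw [← sub_eq_zero] at e ⊢
  rw [← e]
  generalize ⁅R.wm k, R.y 0⁆ = c
  simp only [qb, Ring.lie_def, mul_add, add_mul, smul_mul_assoc, mul_smul_comm, smul_sub, smul_add]
  module

theorem qb_wp_gt (k : ℕ) : qb q (R.wp 0) (R.gt (k + 1)) = ρ • R.wp (k + 1) := by
  rw [← S_wm, ← S_gt, ← S_qb, qb_gt_wm, map_smul, S_wm]

theorem lie_wm_wm (k l : ℕ) : ⁅R.wm k, R.wm l⁆ = 0 := by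
  simp only [wm, lie_smul_left, lie_smul_right, lie_u_u, smul_zero]

theorem lie_wp_wp (k l : ℕ) : ⁅R.wp k, R.wp l⁆ = 0 := by
  simp only [wp, lie_smul_left, lie_smul_right, lie_v_v, smul_zero]

theorem lie_wm_wp (k l : ℕ) : ⁅R.wm k, R.wp l⁆ = ⁅R.wm l, R.wp k⁆ := by
  simp only [wm, wp, lie_smul_left, lie_smul_right, R.lie_u_v 0 0 k l]

theorem lie_wm_G (k l : ℕ) : ⁅R.wm k, R.G (l + 1)⁆ = ⁅R.wm l, R.G (k + 1)⁆ := by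
  simp only [wm, lie_smul_left, R.lie_u_G 0 k l]

theorem lie_G_wp (k l : ℕ) : ⁅R.G (l + 1), R.wp k⁆ = ⁅R.G (k + 1), R.wp l⁆ := by
  simp only [wp, lie_smul_right, R.lie_G_v 0 k l]

theorem lie_gt_G (k l : ℕ) : ⁅R.gt (k + 1), R.G (l + 1)⁆ = ⁅R.gt (l + 1), R.G (k + 1)⁆ := by
  have h : ∀ k l, ⁅⁅R.wm k, R.y 0⁆, R.G (l + 1)⁆ =
      ⁅⁅R.wm k, R.G (l + 1)⁆, R.y 0⁆ - ρ⁻¹ • ⁅R.u 0 k, R.v 1 l⁆ := fun k l => by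
    rw [← R.lie_G_y 0 l, wm, lie_smul_left, lie_smul_left, lie_smul_left, lie_smul_left]
    generalize R.u 0 k = u
    simp only [Ring.lie_def, mul_sub, sub_mul, mul_assoc]
    module
  have h' : ∀ k l, ⁅R.gt (k + 1), R.G (l + 1)⁆ =
      (q + q⁻¹) • ⁅⁅R.wm k, R.y 0⁆, R.G (l + 1)⁆ := fun k l => by
    have e := R.lie_G_G (k + 1) (l + 1)
    rw [gt, ← sub_eq_zero, ← e]
    simp only [Ring.lie_def, mul_add, add_mul, smul_mul_assoc, mul_smul_comm]
    module
  rw [h', h', h, h, lie_wm_G, lie_u_v]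

theorem wm_series : (.mk R.wm : PowerSeries U) = ((q - q⁻¹) / ρ) • (dil q⁻¹ R.X * R.Gs) := by
  rw [div_eq_inv_mul, ← smul_smul, ← mk_u]
  ext n
  simp [wm]

theorem smap_X : smap R.S R.X = R.Y := by simp [X, Y, smap_mk, S_x]

theorem smap_Gs : smap R.S R.Gs = R.Gs := by simp [Gs, smap_mk, S_G]

theorem wp_series : (.mk R.wp : PowerSeries U) = ((q - q⁻¹) / ρ) • (R.Gs * dil q⁻¹ R.Y) := by
  have h := congrArg (smap R.S) R.wm_series
  simpa only [smap_smul, smap_mul R.S_mul, smap_dil, smap_X, smap_Gs, smap_mk, S_wm] using h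

theorem Gs_mul_Y : R.Gs * dil q⁻¹ R.Y = dil q R.Y * R.Gs := by
  have h : smap R.S (R.Gs * dil q R.X) = smap R.S (dil q⁻¹ R.X * R.Gs) :=
    congrArg (smap R.S) R.G_x_series
  simp only [smap_mul R.S_mul, smap_dil, smap_X, smap_Gs] at h
  exact h.symm

theorem Gs_mul_C_y : R.Gs * C (R.y 0) = q⁻¹ ^ 2 • (C (R.y 0) * R.Gs) +
    (1 - q⁻¹ ^ 2) • (dil q R.Y * R.Gs) := by
  have h := congrArg (smap R.S) R.Gs_mul_C
  simp only [smap_sub, smap_smul, smap_mul R.S_mul, smap_C, smap_dil, smap_X, smap_Gs, S_x] at h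
  have hq := R.generic.ne_zero
  rw [← Gs_mul_Y, h]
  match_scalars <;> field_simp
  ring

theorem dil_Gs_mul_C_y (c : K) : dil c R.Gs * C (R.y 0) = q⁻¹ ^ 2 • (C (R.y 0) * dil c R.Gs) +
    (1 - q⁻¹ ^ 2) • (dil (c * q) R.Y * dil c R.Gs) := by
  have h := congrArg (dil c) R.Gs_mul_C_y
  simpa only [dil_mul, dil_add, dil_smul, dil_C, dil_dil] using h

theorem dil_Gs_mul_Y (c : K) :
    dil c R.Gs * dil (c * q⁻¹) R.Y = dil (c * q) R.Y * dil c R.Gs := by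
  have h := congrArg (dil c) R.Gs_mul_Y
  simpa only [dil_mul, dil_dil] using h

/-- The generating series of the `ψ_{n+1}`. -/
def Ψs : PowerSeries U := .mk fun n => R.ψ (n + 1)

theorem qb_C_y_X (c : K) : qb q (C (R.y 0)) (dil c R.X) = dil c R.Ψs := by
  ext n
  have h := congrArg (c ^ n • ·) (R.yx 0 n)
  rw [qb, map_sub, PowerSeries.coeff_smul, PowerSeries.coeff_smul, coeff_C_mul, coeff_mul_C]
  simp only [coeff_dil, X, Ψs, coeff_mk, zero_add, qb, mul_smul_comm, smul_mul_assoc] at h ⊢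
  rw [← h]
  module

theorem qb_Y_X (c : K) : (1 - c) • qb q R.Y (dil c R.X) = R.Ψs - c • dil c R.Ψs := by
  ext n
  have h1 : coeff n (R.Y * dil c R.X) = ∑ i ∈ antidiagonal n, c ^ i.2 • (R.y i.1 * R.x i.2) := by
    simp [coeff_mul, Y, X]
  have h2 : coeff n (dil c R.X * R.Y) = ∑ i ∈ antidiagonal n, c ^ i.2 • (R.x i.2 * R.y i.1) := by
    rw [coeff_mul, ← Finset.Nat.sum_antidiagonal_swap]
    simp [Y, X]
  have h3 : coeff n (qb q R.Y (dil c R.X)) = (∑ i ∈ range (n + 1), c ^ i) • R.ψ (n + 1) := by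
    rw [qb, map_sub, PowerSeries.coeff_smul, PowerSeries.coeff_smul, h1, h2, smul_sum, smul_sum,
      ← sum_sub_distrib, sum_smul, ← Finset.Nat.sum_antidiagonal_swap,
      Finset.Nat.sum_antidiagonal_eq_sum_range_succ_mk]
    refine sum_congr rfl fun i hi => ?_
    have hi := Finset.mem_range_succ_iff.1 hi
    have h := congrArg (c ^ i • ·) (R.yx (n - i) i)
    simp only [qb, Nat.sub_add_cancel hi] at h
    rw [← h]
    simp only [Prod.snd_swap, Prod.fst_swap]
    module
  rw [PowerSeries.coeff_smul, h3, smul_smul, mul_neg_geom_sum, map_sub, PowerSeries.coeff_smul]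
  simp only [coeff_dil, Ψs, coeff_mk]
  module

theorem Ψ_eq : R.Ψ = (-ρ / (q ^ 2 - q⁻¹ ^ 2)) • 1 + R.Ψs * PowerSeries.X := by
  ext n
  rcases n with - | n
  · rw [map_add, PowerSeries.coeff_smul, coeff_zero_mul_X]
    simp [Ψ, ψ_zero, -coeff_zero_eq_constantCoeff]
  · rw [map_add, PowerSeries.coeff_smul, coeff_succ_mul_X]
    simp [Ψ, Ψs, coeff_one]

theorem Ψs_comm (c : K) : Commute R.Ψs (dil c R.Gs) := by
  ext n
  rw [coeff_mul, coeff_mul, ← Finset.Nat.sum_antidiagonal_swap]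
  refine sum_congr rfl fun i _ => ?_
  simp [Ψs, Gs, (R.ψ_comm _ _).eq]

theorem gt_series : (.mk R.gt : PowerSeries U) = R.Gs + (q + q⁻¹) •
    ((.mk R.wm * C (R.y 0) - C (R.y 0) * .mk R.wm) * PowerSeries.X) := by
  ext n
  rcases n with - | n
  · rw [map_add, PowerSeries.coeff_smul, coeff_zero_mul_X]
    simp [Gs, gt, -coeff_zero_eq_constantCoeff]
  · rw [map_add, PowerSeries.coeff_smul, coeff_succ_mul_X]
    simp [Gs, gt, Ring.lie_def]

theorem Ψ_mul_Gs : ((-ρ / (q ^ 2 - q⁻¹ ^ 2)) • 1 + R.Ψs * PowerSeries.X) *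
    (dil q R.Gs * dil q⁻¹ R.Gs) =
    (-ρ / (q ^ 2 - q⁻¹ ^ 2) * (ρ / (q - q⁻¹)) * (ρ / (q - q⁻¹))) • 1 := by
  rw [← Ψ_eq]; exact R.ψ_series

theorem coeff_succ_eq_zero_of_eq_smul {f : PowerSeries U} {c d : K} (e : PowerSeries U)
    (h : f = c • e) (he : e = d • 1) (n : ℕ) : coeff (n + 1) f = 0 := by
  rw [h, he, PowerSeries.coeff_smul, PowerSeries.coeff_smul, coeff_one]
  simp

theorem yEl_wm_wp (n : ℕ) :
    yEl q ρ R.wm R.wp (fun k => R.G (k + 1)) (fun k => R.gt (k + 1)) n = 0 := by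
  have hq := R.generic.ne_zero
  have hκ := R.kappa_ne_zero
  have hs := R.add_inv_ne_zero
  have hρ := R.ρ_ne_zero
  rw [← coeff_eq_yEl hq hρ hκ R.wm R.wp R.gt R.G R.G_zero R.G_zero]
  refine coeff_succ_eq_zero_of_eq_smul (c := -(q + q⁻¹) * ((q - q⁻¹) / ρ) ^ 2) _ ?_ R.Ψ_mul_Gs n
  have h2 : q ^ 2 - q⁻¹ ^ 2 = (q - q⁻¹) * (q + q⁻¹) := by ring
  have hb := R.dil_Gs_mul_C_y q
  have hY := R.dil_Gs_mul_Y q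
  have hY' := R.dil_Gs_mul_Y q⁻¹
  have hP := R.qb_C_y_X (1 : K)
  rw [inv_mul_cancel₀ hq, dil_one] at hY'
  rw [mul_inv_cancel₀ hq, dil_one] at hY
  rw [dil_one, dil_one, qb] at hP
  change _ • (_ * dil q⁻¹ R.Gs) - _ = _
  rw [gt_series, wm_series, wp_series, ← hP]
  simp only [dil_add, dil_sub, dil_smul, dil_mul, dil_dil, dil_X, dil_C, mul_inv_cancel₀ hq,
    dil_one]
  have hk : (q + q⁻¹) * ((q - q⁻¹) / ρ) * (-ρ / (q ^ 2 - q⁻¹ ^ 2)) + 1 = 0 := by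
    rw [h2]
    generalize q - q⁻¹ = κ at *
    generalize q + q⁻¹ = s at *
    field_simp
    ring
  have hb' : ∀ f, dil q R.Gs * (C (R.y 0) * f) = q⁻¹ ^ 2 • (C (R.y 0) * (dil q R.Gs * f)) +
      (1 - q⁻¹ ^ 2) • (dil (q * q) R.Y * (dil q R.Gs * f)) := fun f => by
    rw [← mul_assoc, hb, add_mul, smul_mul_assoc, smul_mul_assoc, mul_assoc, mul_assoc]
  have hYa : ∀ f, dil q R.Gs * (R.Y * f) = dil (q * q) R.Y * (dil q R.Gs * f) := fun f => by
    rw [← mul_assoc, hY, mul_assoc]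
  have hYb : ∀ f, dil q⁻¹ R.Gs * (dil (q⁻¹ * q⁻¹) R.Y * f) = R.Y * (dil q⁻¹ R.Gs * f) := fun f => by
    rw [← mul_assoc, hY', mul_assoc]
  have ht : ∀ f : PowerSeries U, PowerSeries.X * f = f * PowerSeries.X := fun f =>
    (commute_X f).symm.eq
  have e := congrArg (· • (((q - q⁻¹) / ρ) • (dil q R.Gs * dil q⁻¹ R.Gs))) hk
  rw [zero_smul] at e
  rw [← sub_eq_zero, ← e]
  generalize (q - q⁻¹) / ρ = d at *
  generalize -ρ / (q ^ 2 - q⁻¹ ^ 2) = d' at *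
  simp only [mul_add, add_mul, mul_sub, sub_mul, smul_mul_assoc, mul_smul_comm, smul_smul,
    smul_add, smul_sub, mul_assoc, ht, hb', hYa, hYb, one_mul]
  match_scalars <;> field_simp <;> ring

theorem yEl_wp_wm (n : ℕ) :
    yEl q ρ R.wp R.wm (fun k => R.gt (k + 1)) (fun k => R.G (k + 1)) n = 0 := by
  have hq := R.generic.ne_zero
  have hκ := R.kappa_ne_zero
  have hs := R.add_inv_ne_zero
  have hρ := R.ρ_ne_zero
  rw [← coeff_eq_yEl hq hρ hκ R.wp R.wm R.G R.gt R.G_zero R.G_zero]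
  refine coeff_succ_eq_zero_of_eq_smul (c := -(q + q⁻¹) * ((q - q⁻¹) / ρ) ^ 2) _ ?_ R.Ψ_mul_Gs n
  have h2 : q ^ 2 - q⁻¹ ^ 2 = (q - q⁻¹) * (q + q⁻¹) := by ring
  have hb := R.dil_Gs_mul_C_y q⁻¹
  have hP := R.qb_C_y_X (q⁻¹ * q⁻¹)
  have hP' := R.qb_Y_X (q⁻¹ * q⁻¹)
  have hPs : R.Ψs = (1 - q⁻¹ * q⁻¹) • qb q R.Y (dil (q⁻¹ * q⁻¹) R.X) +
      (q⁻¹ * q⁻¹) • qb q (C (R.y 0)) (dil (q⁻¹ * q⁻¹) R.X) := by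
    rw [hP, hP']; abel
  rw [inv_mul_cancel₀ hq, dil_one] at hb
  change _ • (dil q R.Gs * _) - _ = _
  have hk : (q + q⁻¹) * ((q - q⁻¹) / ρ) * (-ρ / (q ^ 2 - q⁻¹ ^ 2)) + 1 = 0 := by
    rw [h2]
    generalize q - q⁻¹ = κ at *
    generalize q + q⁻¹ = s at *
    field_simp
    ring
  have hb' : ∀ f, dil q⁻¹ R.Gs * (C (R.y 0) * f) = q⁻¹ ^ 2 • (C (R.y 0) * (dil q⁻¹ R.Gs * f)) +
      (1 - q⁻¹ ^ 2) • (R.Y * (dil q⁻¹ R.Gs * f)) := fun f => by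
    rw [← mul_assoc, hb, add_mul, smul_mul_assoc, smul_mul_assoc, mul_assoc, mul_assoc]
  have ht : ∀ f : PowerSeries U, PowerSeries.X * f = f * PowerSeries.X := fun f =>
    (commute_X f).symm.eq
  have hc : dil q R.Gs * (R.Ψs * (PowerSeries.X * dil q⁻¹ R.Gs)) =
      R.Ψs * (PowerSeries.X * (dil q R.Gs * dil q⁻¹ R.Gs)) := by
    rw [← mul_assoc, ← (R.Ψs_comm q).eq, mul_assoc, ht, ht, mul_assoc]
  rw [add_mul, mul_assoc R.Ψs, ← hc, hPs, gt_series, wm_series, wp_series]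
  simp only [dil_add, dil_sub, dil_smul, dil_mul, dil_dil, dil_X, dil_C, mul_inv_cancel₀ hq,
    dil_one]
  have e := congrArg (· • (((q - q⁻¹) / ρ) • (dil q R.Gs * dil q⁻¹ R.Gs))) hk
  rw [zero_smul] at e
  rw [← sub_eq_zero, ← e]
  generalize (q - q⁻¹) / ρ = d at *
  generalize -ρ / (q ^ 2 - q⁻¹ ^ 2) = d' at *
  simp only [qb, mul_add, add_mul, mul_sub, sub_mul, smul_mul_assoc, mul_smul_comm, smul_smul,
    smul_add, smul_sub, mul_assoc, ht, hb, one_mul]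
  match_scalars <;> field_simp <;> ring

theorem isAlternating : IsAlternating q ρ R.wm R.wp (fun k => R.G (k + 1))
    (fun k => R.gt (k + 1)) where
  lie_zero := R.lie_wm_zero_wp
  lie_zero' := R.lie_wm_wp_zero
  wm_g := R.qb_wm_G
  gt_wm := R.qb_gt_wm
  g_wp := R.qb_G_wp
  wp_gt := R.qb_wp_gt
  yEl_add n := by rw [yEl_wm_wp, yEl_wp_wm, add_zero]

/-- An automorphism exchanging `x_0` and `y_0` exchanges the alternating elements. -/
theorem map_swap (τ : U →ₐ[K] U) (hx : τ (R.x 0) = R.y 0) (hy : τ (R.y 0) = R.x 0) (n : ℕ) :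
    τ (R.wm n) = R.wp n ∧ τ (R.wp n) = R.wm n ∧ τ (R.G (n + 1)) = R.gt (n + 1) ∧
      τ (R.gt (n + 1)) = R.G (n + 1) :=
  (R.isAlternating.map τ).ext R.generic R.ρ_ne_zero R.isAlternating.swap
    (by rw [wm_zero, wp_zero, hx]) (by rw [wm_zero, wp_zero, hy]) n

theorem lie_wm_gt (τ : U →ₐ[K] U) (hx : τ (R.x 0) = R.y 0) (hy : τ (R.y 0) = R.x 0) (k l : ℕ) :
    ⁅R.wm k, R.gt (l + 1)⁆ = ⁅R.wm l, R.gt (k + 1)⁆ := by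
  have h := congrArg τ (R.lie_G_wp k l)
  have e := R.map_swap τ hx hy
  simp only [Ring.lie_def, map_sub, map_mul, (e _).2.1, (e _).2.2.1] at h ⊢
  rw [← neg_sub, h, neg_sub]

theorem lie_wp_gt (τ : U →ₐ[K] U) (hx : τ (R.x 0) = R.y 0) (hy : τ (R.y 0) = R.x 0) (k l : ℕ) :
    ⁅R.wp k, R.gt (l + 1)⁆ = ⁅R.wp l, R.gt (k + 1)⁆ := by
  have h := congrArg τ (R.lie_wm_G k l)
  have e := R.map_swap τ hx hy
  simpa only [Ring.lie_def, map_sub, map_mul, (e _).1, (e _).2.2.1] using h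

theorem lie_gt_gt (τ : U →ₐ[K] U) (hx : τ (R.x 0) = R.y 0) (hy : τ (R.y 0) = R.x 0) (k l : ℕ) :
    ⁅R.gt (k + 1), R.gt (l + 1)⁆ = 0 := by
  have h := congrArg τ (R.lie_G_G (k + 1) (l + 1))
  have e := R.map_swap τ hx hy
  simpa only [Ring.lie_def, map_sub, map_mul, map_zero, (e _).2.2.1] using h

end RootSystem

section
variable {K U : Type*} [Field K] [Ring U] [Algebra K U] {q ρ : K}

theorem gSeq_one {e g : K} (he : e ≠ 0) (hg : g ≠ 0) (p : ℕ → U) :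
    gSeq q e g p 1 = -(g / (e * (q + q⁻¹))) • p 1 := by
  have h : coeff 1 (.mk p * (dil q (.mk (trunc q e g p 0)) *
      dil q⁻¹ (.mk (trunc q e g p 0)))) = (g * g) • p 1 := by
    simp [coeff_mul, Finset.Nat.antidiagonal_succ, trunc, Function.update, smul_smul,
      -coeff_zero_eq_constantCoeff]
  rw [gSeq_succ, h, smul_smul]
  congr 1
  simp only [zero_add, pow_one]
  rw [mul_inv, mul_inv, div_eq_mul_inv, mul_inv]
  field_simp

/-- The root system generated by two elements subject to a `q`-Serre relation which are exchanged
by an antiautomorphism. -/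
def RootSystem.ofSerre {a b : U} (hq : IsGeneric q) (hρ : ρ ≠ 0) (S : U →ₗ[K] U)
    (hS : ∀ x y, S (x * y) = S y * S x) (ha : S a = b) (hb : S b = a) (h1 : S 1 = 1)
    (h00 : xxDefect q (-ρ⁻¹) a b 0 0 = 0) : RootSystem q ρ U := by
  have hr : -ρ⁻¹ ≠ 0 := neg_ne_zero.2 (inv_ne_zero hρ)
  have hκ : q - q⁻¹ ≠ 0 := by simpa using hq.sub_ne_zero one_pos
  have hs : q + q⁻¹ ≠ 0 := by simpa using hq.add_ne_zero 1
  have hd : q ^ 2 - q⁻¹ ^ 2 ≠ 0 := hq.sub_ne_zero two_pos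
  have he : -ρ / (q ^ 2 - q⁻¹ ^ 2) ≠ 0 := div_ne_zero (neg_ne_zero.2 hρ) hd
  have hg : ρ / (q - q⁻¹) ≠ 0 := div_ne_zero hρ hκ
  set ψ := psi q (-ρ⁻¹) a b with hψ
  set x := xr q (-ρ⁻¹) a b with hx
  set G : ℕ → U := gSeq q (-ρ / (q ^ 2 - q⁻¹ ^ 2)) (ρ / (q - q⁻¹)) ψ with hG
  have hψ0 : ψ 0 = (-ρ / (q ^ 2 - q⁻¹ ^ 2)) • 1 := by
    rw [hψ, psi, mul_inv, inv_neg, inv_inv, div_eq_mul_inv]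
  have hψψ := psi_commute hq hr hS ha hb h1 h00
  have hψA : ∀ n, ψ n ∈ Algebra.adjoin K (Set.range ψ) := fun n =>
    Algebra.subset_adjoin ⟨n, rfl⟩
  have hGA : ∀ n, G n ∈ Algebra.adjoin K (Set.range ψ) := gSeq_mem hψA
  have hcomm : ∀ z ∈ Algebra.adjoin K (Set.range ψ), ∀ w ∈ Algebra.adjoin K (Set.range ψ),
      Commute z w := by
    intro z hz w hw
    refine Algebra.commute_of_mem_adjoin_of_forall_mem_commute hw fun y hy => ?_
    obtain ⟨j, rfl⟩ := hy
    refine (Algebra.commute_of_mem_adjoin_of_forall_mem_commute hz fun y hy => ?_).symm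
    obtain ⟨i, rfl⟩ := hy
    exact hψψ j i
  have hSA : ∀ z ∈ Algebra.adjoin K (Set.range ψ), S z = z := by
    intro z hz
    induction hz using Algebra.adjoin_induction with
    | mem z hz => obtain ⟨j, rfl⟩ := hz; exact map_psi hq hr hS ha hb h1 h00 j
    | algebraMap c => rw [Algebra.algebraMap_eq_smul_one, map_smul, h1]
    | add z w _ _ hz hw => rw [map_add, hz, hw]
    | mul z w hz' hw' hz hw => rw [hS, hz, hw, (hcomm z hz' w hw').eq]
  have hψx : ∀ k l, ψ (k + 1) * x l - x l * ψ (k + 1) =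
      q ^ 2 • (ψ k * x (l + 1)) - q⁻¹ ^ 2 • (x (l + 1) * ψ k) := fun k l => by
    have h := psixDefect_eq hq hr hS ha hb h1 h00 k l
    rw [← sub_eq_zero, ← h, psixDefect]
    abel
  have hGs : (.mk ψ * (dil q (.mk G) * dil q⁻¹ (.mk G)) : PowerSeries U) = _ :=
    gSeq_equation he hg hq hψ0
  have hser : ∀ l, (.mk G * dil q (.mk fun j => x (l + j)) : PowerSeries U) =
      dil q⁻¹ (.mk fun j => x (l + j)) * .mk G := by
    intro l
    refine sqrt_exchange (P := .mk ψ) hq (mul_ne_zero (mul_ne_zero he hg) hg) (g := ρ / (q - q⁻¹))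
      ?_ (e := -ρ / (q ^ 2 - q⁻¹ ^ 2)) ?_ rfl ?_ hGs ?_
    · rw [coeff_mk, hG, gSeq_zero]
    · rw [coeff_mk, hψ0]
    · ext n
      rw [coeff_mul, coeff_mul, ← Finset.Nat.sum_antidiagonal_swap]
      refine sum_congr rfl fun i _ => ?_
      simp [(hcomm _ (hψA i.2) _ (hGA i.1)).eq]
    · refine series_exchange hd (fun z => ?_) fun k j => ?_
      · rw [hψ0]; simp [Commute, SemiconjBy]
      · exact hψx k (l + j)
  exact
  { generic := hq
    ρ_ne_zero := hρ
    x := x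
    y := yr q (-ρ⁻¹) a b
    G := G
    ψ := ψ
    S := S
    S_mul := hS
    S_x := map_xr hS ha hb
    S_y := map_yr hS ha hb
    S_G := fun n => hSA _ (hGA n)
    yx := yx_eq_psi hq hr hS ha hb h1 h00
    xx := xxDefect_eq hq hr hS ha hb h1 h00
    G_comm := fun i j => hcomm _ (hGA i) _ (hGA j)
    ψ_comm := fun i j => hcomm _ (hψA i) _ (hGA j)
    G_zero := gSeq_zero
    G_one := by
      rw [hG, gSeq_one he hg]
      have h2 : q ^ 2 - q⁻¹ ^ 2 = (q - q⁻¹) * (q + q⁻¹) := by ring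
      have h : -(ρ / (q - q⁻¹) / (-ρ / (q ^ 2 - q⁻¹ ^ 2) * (q + q⁻¹))) = 1 := by
        rw [h2]
        generalize q - q⁻¹ = κ at *
        generalize q + q⁻¹ = s at *
        field_simp
      rw [h, one_smul]
    ψ_zero := hψ0
    G_x := exchange_of_series hser
    G_x_series := by simpa using hser 0
    ψ_series := hGs }

end

section
variable {K U : Type*} [Field K] [Ring U] [Algebra K U] {q ρ : K}

theorem lie_qb_self (x y : U) : ⁅x, qb q x y⁆ = qb q x ⁅x, y⁆ := by
  simp only [qb, Ring.lie_def, mul_sub, sub_mul, mul_smul_comm, smul_mul_assoc, mul_assoc]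
  module

theorem IsAlternating.serre (hs : q + q⁻¹ ≠ 0) {wm wp g gt : ℕ → U}
    (h : IsAlternating q ρ wm wp g gt) (hw : ⁅wm 0, wm 1⁆ = 0) :
    ⁅wm 0, qb q (wm 0) (qb q (wp 0) (wm 0))⁆ = 0 := by
  have hgt : gt 0 = g 0 + (q + q⁻¹) • ⁅wm 0, wp 0⁆ := by
    rw [h.lie_zero, smul_smul, mul_inv_cancel₀ hs, one_smul, add_sub_cancel]
  have hg : ⁅wm 0, g 0⁆ = ⁅wm 0, qb q (wp 0) (wm 0)⁆ := by
    refine smul_right_injective U hs ?_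
    have e := (h.wm_g 0).trans (h.gt_wm 0).symm
    rw [hgt, ← sub_eq_zero] at e
    change (q + q⁻¹) • _ = (q + q⁻¹) • _
    rw [← sub_eq_zero, ← e]
    simp only [qb, Ring.lie_def, mul_sub, sub_mul, mul_add, add_mul, smul_sub, smul_add,
      mul_smul_comm, smul_mul_assoc, mul_assoc, smul_smul]
    module
  rw [lie_qb_self, ← hg, ← lie_qb_self, h.wm_g, lie_smul_right, hw, smul_zero]

theorem lie_lie_eq_neg_lie (x y : U) :
    x * (q⁻¹ • (x * qb q x y) - q • (qb q x y * x)) -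
      (q⁻¹ • (x * qb q x y) - q • (qb q x y * x)) * x = -⁅x, qb q x (qb q y x)⁆ := by
  simp only [qb, Ring.lie_def, mul_sub, sub_mul, mul_smul_comm, smul_mul_assoc, mul_assoc,
    smul_sub, smul_smul]
  module

theorem lie_qb_qb_eq (hq : q ≠ 0) (x y : U) : ⁅x, qb q x (qb q y x)⁆ =
    y * x * x * x - (q ^ 2 + 1 + q⁻¹ ^ 2) • (x * y * x * x) +
      (q ^ 2 + 1 + q⁻¹ ^ 2) • (x * x * y * x) - x * x * x * y := by
  simp only [qb, Ring.lie_def, mul_sub, sub_mul, mul_smul_comm, smul_mul_assoc, mul_assoc,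
    smul_sub, smul_smul]
  match_scalars <;> field_simp <;> ring

end
end Half

open Half

theorem isGeneric_q : IsGeneric q where
  ne_zero := RatFunc.X_ne_zero
  two_ne_zero := two_ne_zero
  pow_ne_one n hn h := by
    have h' : algebraMap (Polynomial ℚ) F (Polynomial.X ^ n) = algebraMap (Polynomial ℚ) F 1 := by
      rw [map_pow, RatFunc.algebraMap_X, map_one]; exact h
    have := congrArg Polynomial.natDegree (RatFunc.algebraMap_injective ℚ h')
    simp at this
    omega

section Serre
variable {A B : Type*} [Ring A] [Algebra F A] [Ring B] [Algebra F B]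

/-- The left-hand side of a `q`-Serre relation. -/
def serre (x y : A) : A := br x (qbr' x (qbr x y))

theorem map_serre (f : A →ₐ[F] B) (x y : A) : f (serre x y) = serre (f x) (f y) := by
  simp only [serre, br, qbr', qbr, map_sub, map_mul, map_smul]

theorem serre_eq_neg_lie (x y : A) : serre x y = -⁅x, qb q x (qb q y x)⁆ :=
  lie_lie_eq_neg_lie x y

theorem serre_eq (x y : A) : serre x y =
    -(y * x * x * x - (q ^ 2 + 1 + q⁻¹ ^ 2) • (x * y * x * x) +
      (q ^ 2 + 1 + q⁻¹ ^ 2) • (x * x * y * x) - x * x * x * y) := by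
  rw [serre_eq_neg_lie, lie_qb_qb_eq isGeneric_q.ne_zero]

theorem serre_op (x y : A) :
    serre (MulOpposite.op x) (MulOpposite.op y) = -MulOpposite.op (serre x y) := by
  rw [serre_eq, serre_eq]
  apply MulOpposite.unop_injective
  simp only [MulOpposite.unop_neg, MulOpposite.unop_sub, MulOpposite.unop_add,
    MulOpposite.unop_mul, MulOpposite.unop_op, MulOpposite.unop_smul, mul_assoc]
  abel

/-- The homomorphism from `U_q^{DJ,+}` determined by the images of `E_0` and `E_1`. -/
def liftE (x y : A) (hxy : serre x y = 0) (hyx : serre y x = 0) : UqDJp →ₐ[F] A :=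
  RingQuot.liftAlgHom F ⟨FreeAlgebra.lift F fun | .e0 => x | .e1 => y, by
    intro z w h
    have h0 : FreeAlgebra.lift F (fun | .e0 => x | .e1 => y) (fE .e0) = x :=
      FreeAlgebra.lift_ι_apply _ _
    have h1 : FreeAlgebra.lift F (fun | .e0 => x | .e1 => y) (fE .e1) = y :=
      FreeAlgebra.lift_ι_apply _ _
    rcases h with _ | _
    · rw [← serre, map_serre, h0, h1, hxy, map_zero]
    · rw [← serre, map_serre, h0, h1, hyx, map_zero]⟩

theorem liftE_E0 (x y : A) (hxy : serre x y = 0) (hyx : serre y x = 0) :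
    liftE x y hxy hyx E0 = x := by
  rw [liftE, E0, RingQuot.liftAlgHom_mkAlgHom_apply]
  exact FreeAlgebra.lift_ι_apply _ _

theorem liftE_E1 (x y : A) (hxy : serre x y = 0) (hyx : serre y x = 0) :
    liftE x y hxy hyx E1 = y := by
  rw [liftE, E1, RingQuot.liftAlgHom_mkAlgHom_apply]
  exact FreeAlgebra.lift_ι_apply _ _

theorem UqDJp.hom_ext {f g : UqDJp →ₐ[F] A} (h0 : f E0 = g E0) (h1 : f E1 = g E1) : f = g := by
  apply RingQuot.ringQuot_ext'
  apply FreeAlgebra.hom_ext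
  funext i
  rcases i with _ | _
  · exact h0
  · exact h1

end Serre

theorem serre_E0_E1 : serre E0 E1 = 0 := by
  have h := RingQuot.mkAlgHom_rel F relE.s01
  rwa [← serre, map_serre, map_zero] at h

theorem serre_E1_E0 : serre E1 E0 = 0 := by
  have h := RingQuot.mkAlgHom_rel F relE.s10
  rwa [← serre, map_serre, map_zero] at h

/-- The automorphism of `U_q^{DJ,+}` exchanging `E_0` and `E_1`. -/
def swapE : UqDJp →ₐ[F] UqDJp := liftE E1 E0 serre_E1_E0 serre_E0_E1

/-- The antiautomorphism of `U_q^{DJ,+}` exchanging `E_0` and `E_1`. -/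
def antiE : UqDJp →ₗ[F] UqDJp :=
  (MulOpposite.opLinearEquiv F).symm.toLinearMap ∘ₗ
    (liftE (MulOpposite.op E1) (MulOpposite.op E0)
      (by rw [serre_op, serre_E1_E0]; simp) (by rw [serre_op, serre_E0_E1]; simp)).toLinearMap

/-- The root system of `U_q^{DJ,+}`. -/
def rootSystem {ρ : F} (hρ : ρ ≠ 0) : RootSystem q ρ UqDJp :=
  .ofSerre (a := E1) (b := E0) isGeneric_q hρ antiE (fun x y => by simp [antiE])
    (by simp [antiE, liftE_E1]) (by simp [antiE, liftE_E0]) (by simp [antiE])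
    (xxDefect_zero_zero isGeneric_q.ne_zero (neg_eq_zero.1 ((serre_eq _ _).symm.trans serre_E1_E0)))

section Main
variable {ρ : F} (hρ : ρ ≠ 0)

theorem rootSystem_x_zero : (rootSystem hρ).x 0 = E1 := rfl

theorem rootSystem_y_zero : (rootSystem hρ).y 0 = E0 := rfl

/-- The images of the generators of `𝒜q` in `U_q^{DJ,+}`. -/
def genImage : Gen → UqDJp
  | .wm k => (rootSystem hρ).wm k
  | .wp k => (rootSystem hρ).wp k
  | .g k => (rootSystem hρ).G (k + 1)
  | .gt k => (rootSystem hρ).gt (k + 1)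

theorem map_br {A B : Type*} [Ring A] [Algebra F A] [Ring B] [Algebra F B] (f : A →ₐ[F] B)
    (x y : A) : f (br x y) = ⁅f x, f y⁆ := by
  simp only [br, map_sub, map_mul, Ring.lie_def]

theorem map_qbr {A B : Type*} [Ring A] [Algebra F A] [Ring B] [Algebra F B] (f : A →ₐ[F] B)
    (x y : A) : f (qbr x y) = qb q (f x) (f y) := map_qb f x y

/-- The homomorphism from `𝒜q` to `U_q^{DJ,+}`. -/
def AqToU : Aq ρ →ₐ[F] UqDJp :=
  RingQuot.liftAlgHom F ⟨FreeAlgebra.lift F (genImage hρ), by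
    have e1 : ∀ k, FreeAlgebra.lift F (genImage hρ) (fWm k) = (rootSystem hρ).wm k := fun k =>
      FreeAlgebra.lift_ι_apply _ _
    have e2 : ∀ k, FreeAlgebra.lift F (genImage hρ) (fWp k) = (rootSystem hρ).wp k := fun k =>
      FreeAlgebra.lift_ι_apply _ _
    have e3 : ∀ k, FreeAlgebra.lift F (genImage hρ) (fG k) = (rootSystem hρ).G (k + 1) := fun k =>
      FreeAlgebra.lift_ι_apply _ _
    have e4 : ∀ k, FreeAlgebra.lift F (genImage hρ) (fGt k) = (rootSystem hρ).gt (k + 1) :=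
      fun k => FreeAlgebra.lift_ι_apply _ _
    have hx : swapE ((rootSystem hρ).x 0) = (rootSystem hρ).y 0 := liftE_E1 _ _ _ _
    have hy : swapE ((rootSystem hρ).y 0) = (rootSystem hρ).x 0 := liftE_E0 _ _ _ _
    have hsum : ∀ x y z w : UqDJp, ⁅x, y⁆ = ⁅z, w⁆ → ⁅x, y⁆ + ⁅w, z⁆ = 0 := fun x y z w h => by
      rw [h, lie_swap w, add_neg_cancel]
    intro z w h
    rcases h with _ | _ | _ | _ | _ | _ | _ | _ | _ | _ | _ | _ | _ | _ | _ | _ <;>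
      simp only [map_add, map_sub, map_smul, map_br, map_qbr, map_zero, e1, e2, e3, e4]
    · exact (rootSystem hρ).lie_wm_zero_wp _
    · exact (rootSystem hρ).lie_wm_wp_zero _
    · exact (rootSystem hρ).qb_wm_G _
    · exact (rootSystem hρ).qb_gt_wm _
    · exact (rootSystem hρ).qb_G_wp _
    · exact (rootSystem hρ).qb_wp_gt _
    · exact (rootSystem hρ).lie_wm_wm _ _
    · exact (rootSystem hρ).lie_wp_wp _ _
    · exact hsum _ _ _ _ ((rootSystem hρ).lie_wm_wp _ _)
    · exact hsum _ _ _ _ ((rootSystem hρ).lie_wm_G _ _)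
    · exact hsum _ _ _ _ ((rootSystem hρ).lie_wm_gt swapE hx hy _ _)
    · rw [add_comm]; exact hsum _ _ _ _ ((rootSystem hρ).lie_G_wp _ _)
    · exact hsum _ _ _ _ ((rootSystem hρ).lie_wp_gt swapE hx hy _ _)
    · exact (rootSystem hρ).lie_G_G _ _
    · exact (rootSystem hρ).lie_gt_gt swapE hx hy _ _
    · exact hsum _ _ _ _ ((rootSystem hρ).lie_gt_G _ _)⟩

theorem AqToU_Wm (k : ℕ) : AqToU hρ (Wm ρ k) = (rootSystem hρ).wm k := by
  rw [AqToU, Wm, RingQuot.liftAlgHom_mkAlgHom_apply]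
  exact FreeAlgebra.lift_ι_apply _ _

theorem AqToU_Wp (k : ℕ) : AqToU hρ (Wp ρ k) = (rootSystem hρ).wp k := by
  rw [AqToU, Wp, RingQuot.liftAlgHom_mkAlgHom_apply]
  exact FreeAlgebra.lift_ι_apply _ _

theorem AqToU_G (k : ℕ) : AqToU hρ (G ρ k) = (rootSystem hρ).G (k + 1) := by
  rw [AqToU, G, RingQuot.liftAlgHom_mkAlgHom_apply]
  exact FreeAlgebra.lift_ι_apply _ _

theorem AqToU_Gt (k : ℕ) : AqToU hρ (Gt ρ k) = (rootSystem hρ).gt (k + 1) := by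
  rw [AqToU, Gt, RingQuot.liftAlgHom_mkAlgHom_apply]
  exact FreeAlgebra.lift_ι_apply _ _

/-- Two homomorphisms from `𝒜q` agreeing on the generators are equal. -/
theorem Aq.hom_ext {A : Type*} [Ring A] [Algebra F A] {f g : Aq ρ →ₐ[F] A}
    (h1 : ∀ k, f (Wm ρ k) = g (Wm ρ k)) (h2 : ∀ k, f (Wp ρ k) = g (Wp ρ k))
    (h3 : ∀ k, f (G ρ k) = g (G ρ k)) (h4 : ∀ k, f (Gt ρ k) = g (Gt ρ k)) : f = g := by
  apply RingQuot.ringQuot_ext'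
  apply FreeAlgebra.hom_ext
  funext i
  rcases i with k | k | k | k
  exacts [h1 k, h2 k, h3 k, h4 k]

theorem mkAlgHom_rel_eq {A : Type*} [Ring A] [Algebra F A] (f : Aq ρ →ₐ[F] A) {z w : FA}
    (h : rel ρ z w) :
    f.comp (RingQuot.mkAlgHom F (rel ρ)) z = f.comp (RingQuot.mkAlgHom F (rel ρ)) w :=
  congrArg f (RingQuot.mkAlgHom_rel F h)

section Quotient
variable (σ : Aq ρ ≃ₐ[F] Aq ρ)
    (hσ1 : ∀ k : ℕ, σ (Wm ρ k) = Wp ρ k) (hσ2 : ∀ k : ℕ, σ (Wp ρ k) = Wm ρ k)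
    (hσ3 : ∀ k : ℕ, σ (G ρ k) = Gt ρ k) (hσ4 : ∀ k : ℕ, σ (Gt ρ k) = G ρ k)
include hσ1 hσ2 hσ3 hσ4

theorem map_Y (n : ℕ) : σ (Y ρ n) = yEl q ρ (Wp ρ) (Wm ρ) (Gt ρ) (G ρ) n := by
  have h : σ (Y ρ n) = yEl q ρ (fun k => σ (Wm ρ k)) (fun k => σ (Wp ρ k)) (fun k => σ (G ρ k))
      (fun k => σ (Gt ρ k)) n := map_yEl σ.toAlgHom (Wm ρ) (Wp ρ) (G ρ) (Gt ρ) n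
  simp only [hσ1, hσ2, hσ3, hσ4] at h
  exact h

theorem map_Δd {A : Type*} [Ring A] [Algebra F A] (f : Aq ρ →ₐ[F] A) (n : ℕ) :
    f (Δd ρ σ n) = (q ^ ((n : ℤ) + 1) + q ^ (-(n : ℤ) - 1))⁻¹ •
      (yEl q ρ (fun k => f (Wm ρ k)) (fun k => f (Wp ρ k)) (fun k => f (G ρ k))
        (fun k => f (Gt ρ k)) n +
      yEl q ρ (fun k => f (Wp ρ k)) (fun k => f (Wm ρ k)) (fun k => f (Gt ρ k))
        (fun k => f (G ρ k)) n) := by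
  have hY : Y ρ n = yEl q ρ (Wm ρ) (Wp ρ) (G ρ) (Gt ρ) n := rfl
  rw [Δd, map_Y σ hσ1 hσ2 hσ3 hσ4, hY, map_smul, map_add, map_yEl, map_yEl]

theorem AqToU_Δd (n : ℕ) : AqToU hρ (Δd ρ σ n) = 0 := by
  rw [map_Δd σ hσ1 hσ2 hσ3 hσ4]
  simp only [AqToU_Wm, AqToU_Wp, AqToU_G, AqToU_Gt]
  rw [(rootSystem hρ).isAlternating.yEl_add, smul_zero]

/-- A homomorphism from `𝒜q` annihilating every `Δ_{k+1}` sends the generators to alternating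
generators. -/
theorem isAlternating_of_Δd {A : Type*} [Ring A] [Algebra F A] (f : Aq ρ →ₐ[F] A)
    (hf : ∀ n, f (Δd ρ σ n) = 0) : IsAlternating q ρ (fun k => f (Wm ρ k))
    (fun k => f (Wp ρ k)) (fun k => f (G ρ k)) (fun k => f (Gt ρ k)) where
  lie_zero k := by
    have h := mkAlgHom_rel_eq f (rel.r1a k)
    rwa [map_br, map_smul, map_sub] at h
  lie_zero' k := by
    have h := mkAlgHom_rel_eq f (rel.r1b k)
    rwa [map_br, map_smul, map_sub] at h
  wm_g k := by
    have h := mkAlgHom_rel_eq f (rel.r2a k)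
    rwa [map_qbr, map_smul] at h
  gt_wm k := by
    have h := mkAlgHom_rel_eq f (rel.r2b k)
    rwa [map_qbr, map_smul] at h
  g_wp k := by
    have h := mkAlgHom_rel_eq f (rel.r3a k)
    rwa [map_qbr, map_smul] at h
  wp_gt k := by
    have h := mkAlgHom_rel_eq f (rel.r3b k)
    rwa [map_qbr, map_smul] at h
  yEl_add n := by
    have hc : q ^ ((n : ℤ) + 1) + q ^ (-(n : ℤ) - 1) ≠ 0 := by
      have h := isGeneric_q.add_ne_zero (n + 1)
      rwa [inv_pow, ← zpow_natCast, ← zpow_neg, show -((n + 1 : ℕ) : ℤ) = -(n : ℤ) - 1 by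
        push_cast; ring, Nat.cast_succ] at h
    have h := hf n
    rw [map_Δd σ hσ1 hσ2 hσ3 hσ4] at h
    exact (smul_eq_zero.1 h).resolve_left (inv_ne_zero hc)

theorem serre_Wm_Wp {A : Type*} [Ring A] [Algebra F A] (f : Aq ρ →ₐ[F] A)
    (hf : ∀ n, f (Δd ρ σ n) = 0) : serre (f (Wm ρ 0)) (f (Wp ρ 0)) = 0 := by
  have h := mkAlgHom_rel_eq f (rel.r4a 0 1)
  rw [map_br, map_zero] at h
  rw [serre_eq_neg_lie, (isAlternating_of_Δd σ hσ1 hσ2 hσ3 hσ4 f hf).serre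
    (by simpa using isGeneric_q.add_ne_zero 1) h]
  exact neg_zero

theorem serre_Wp_Wm {A : Type*} [Ring A] [Algebra F A] (f : Aq ρ →ₐ[F] A)
    (hf : ∀ n, f (Δd ρ σ n) = 0) : serre (f (Wp ρ 0)) (f (Wm ρ 0)) = 0 := by
  have h := mkAlgHom_rel_eq f (rel.r4b 0 1)
  rw [map_br, map_zero] at h
  rw [serre_eq_neg_lie, (isAlternating_of_Δd σ hσ1 hσ2 hσ3 hσ4 f hf).swap.serre
    (by simpa using isGeneric_q.add_ne_zero 1) h]
  exact neg_zero

end Quotient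
end Main

/-- `Āq ≅ U_q^{DJ,+}` as `F`-algebras, by an isomorphism sending the image of
`W_0` to `E_1` and the image of `W_1` to `E_0`.  Here `σ` is the algebra
automorphism of `𝒜q` exchanging the two kinds of generators. -/
theorem statement8 (ρ : F) (hρ : ρ ≠ 0) (σ : Aq ρ ≃ₐ[F] Aq ρ)
    (hσ1 : ∀ k : ℕ, σ (Wm ρ k) = Wp ρ k) (hσ2 : ∀ k : ℕ, σ (Wp ρ k) = Wm ρ k)
    (hσ3 : ∀ k : ℕ, σ (G ρ k) = Gt ρ k) (hσ4 : ∀ k : ℕ, σ (Gt ρ k) = G ρ k) :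
    ∃ φ : Abar ρ σ ≃ₐ[F] UqDJp,
      φ (RingQuot.mkAlgHom F (relD ρ σ) (Wm ρ 0)) = E1 ∧
      φ (RingQuot.mkAlgHom F (relD ρ σ) (Wp ρ 0)) = E0 := by
  let p : Aq ρ →ₐ[F] Abar ρ σ := RingQuot.mkAlgHom F (relD ρ σ)
  have hp : ∀ n, p (Δd ρ σ n) = 0 := fun n =>
    (RingQuot.mkAlgHom_rel F (relD.mk n)).trans (map_zero _)
  have hA := isAlternating_of_Δd (A := Abar ρ σ) σ hσ1 hσ2 hσ3 hσ4 p hp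
  let f : Abar ρ σ →ₐ[F] UqDJp := RingQuot.liftAlgHom F ⟨AqToU hρ, by
    rintro _ _ ⟨n⟩
    rw [AqToU_Δd hρ σ hσ1 hσ2 hσ3 hσ4, map_zero]⟩
  have hf : ∀ z, f (RingQuot.mkAlgHom F (relD ρ σ) z) = AqToU hρ z := fun z =>
    RingQuot.liftAlgHom_mkAlgHom_apply _ _ _ _
  let g : UqDJp →ₐ[F] Abar ρ σ := liftE (p (Wp ρ 0)) (p (Wm ρ 0))
    (serre_Wp_Wm (A := Abar ρ σ) σ hσ1 hσ2 hσ3 hσ4 p hp)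
    (serre_Wm_Wp (A := Abar ρ σ) σ hσ1 hσ2 hσ3 hσ4 p hp)
  have hg0 : g E0 = p (Wp ρ 0) := liftE_E0 _ _ _ _
  have hg1 : g E1 = p (Wm ρ 0) := liftE_E1 _ _ _ _
  have hf0 : f (RingQuot.mkAlgHom F (relD ρ σ) (Wp ρ 0)) = E0 := by
    rw [hf, AqToU_Wp, RootSystem.wp_zero, rootSystem_y_zero]
  have hf1 : f (RingQuot.mkAlgHom F (relD ρ σ) (Wm ρ 0)) = E1 := by
    rw [hf, AqToU_Wm, RootSystem.wm_zero, rootSystem_x_zero]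
  have hfg : f.comp g = AlgHom.id F UqDJp := UqDJp.hom_ext
    ((congrArg f hg0).trans hf0) ((congrArg f hg1).trans hf1)
  have hgen := ((rootSystem hρ).isAlternating.map g).ext isGeneric_q hρ hA
    (by rw [RootSystem.wm_zero, rootSystem_x_zero, hg1])
    (by rw [RootSystem.wp_zero, rootSystem_y_zero, hg0])
  have hgf : g.comp f = AlgHom.id F (Abar ρ σ) := by
    apply RingQuot.ringQuot_ext'
    refine Aq.hom_ext (A := Abar ρ σ) (fun k => ?_) (fun k => ?_) (fun k => ?_) fun k => ?_
    · exact (congrArg g ((hf _).trans (AqToU_Wm hρ k))).trans (hgen k).1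
    · exact (congrArg g ((hf _).trans (AqToU_Wp hρ k))).trans (hgen k).2.1
    · exact (congrArg g ((hf _).trans (AqToU_G hρ k))).trans (hgen k).2.2.1
    · exact (congrArg g ((hf _).trans (AqToU_Gt hρ k))).trans (hgen k).2.2.2
  exact ⟨AlgEquiv.ofAlgHom f g hfg hgf, hf1, hf0⟩

end Alt
end
end
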